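/- Let $G$ be a finite graph embedded in a closed orientable surface of genus $g$, with every vertex of degree at least 2 and at least $n$ vertices of degree at least 3, and suppose a fixed collection of $h$ of its faces is distinguished. Then the number of non-distinguished faces $f'$ satisfies $f' \geq \frac{n}{2} + 2 - 2g - h$. -/

import Mathlib

/-- A finite graph embedded in a topological space `S`: a finite set of
vertices and finitely many edges, each a simple curve parametrized by `[0,1]`
with endpoints at vertices, whose interiors are pairwise disjoint and avoid
the vertices.  Edges which are loops (closed curves through a vertex) are
allowed: the parametrization is injective on `[0,1)`. -/
structure EmbeddedGraph (S : Type) [TopologicalSpace S] where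
  verts : Finset S
  edges : Finset ℕ
  param : ℕ → ℝ → S
  cont : ∀ i ∈ edges, ContinuousOn (param i) (Set.Icc 0 1)
  inj : ∀ i ∈ edges, Set.InjOn (param i) (Set.Ico 0 1)
  endpoint₀ : ∀ i ∈ edges, param i 0 ∈ verts
  endpoint₁ : ∀ i ∈ edges, param i 1 ∈ verts
  interior_avoids_verts : ∀ i ∈ edges, ∀ t ∈ Set.Ioo (0 : ℝ) 1,
    param i t ∉ (verts : Set S)
  interiors_disjoint : ∀ i ∈ edges, ∀ j ∈ edges, i ≠ j →
    ∀ s ∈ Set.Ioo (0 : ℝ) 1, ∀ t ∈ Set.Ioo (0 : ℝ) 1, param i s ≠ param j t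

/-- The underlying closed subset of `S` covered by the graph. -/
def EmbeddedGraph.carrier {S : Type} [TopologicalSpace S] (G : EmbeddedGraph S) :
    Set S :=
  (G.verts : Set S) ∪ ⋃ i ∈ G.edges, G.param i '' Set.Icc 0 1

/-- Number of faces: connected components of the complement of the graph. -/
noncomputable def EmbeddedGraph.numFaces {S : Type} [TopologicalSpace S]
    (G : EmbeddedGraph S) : ℕ :=
  Nat.card (ConnectedComponents ↥(G.carrierᶜ))

/-- Number of connected components of the graph itself. -/
noncomputable def EmbeddedGraph.numComponents {S : Type} [TopologicalSpace S]
    (G : EmbeddedGraph S) : ℕ :=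
  Nat.card (ConnectedComponents ↥G.carrier)

/-- `S` is a closed surface of Euler characteristic `2 - 2g` (the closed
orientable surface of genus `g`): it is a compact connected Hausdorff
topological `2`-manifold which carries an embedded graph all of whose faces
are open disks, with `v - e + f = 2 - 2g`. -/
def IsClosedSurfaceOfGenus (S : Type) [TopologicalSpace S] (g : ℕ) : Prop :=
  CompactSpace S ∧ ConnectedSpace S ∧ T2Space S ∧
    (∀ x : S, ∃ U : Set S, IsOpen U ∧ x ∈ U ∧ Nonempty (↥U ≃ₜ (ℝ × ℝ))) ∧
    ∃ G₀ : EmbeddedGraph S,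
      (∀ x ∈ G₀.carrierᶜ,
        Nonempty (↥(connectedComponentIn G₀.carrierᶜ x) ≃ₜ (ℝ × ℝ))) ∧
      (G₀.verts.card : ℤ) - (G₀.edges.card : ℤ) + (G₀.numFaces : ℤ) = 2 - 2 * g

section
open Set Filter Topology

namespace EG

/-- `u` is a primitive of the cochain `c` near `x`. -/
def Pr {X : Type*} [TopologicalSpace X] (c : X → X → ZMod 2) (u : X → ZMod 2) (x : X) : Prop :=
  ∃ N ∈ 𝓝 x, ∀ a ∈ N, ∀ b ∈ N, c a b = u a + u b

/-- `c` is a cocycle near `x`. -/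
def LC {X : Type*} [TopologicalSpace X] (c : X → X → ZMod 2) (x : X) : Prop :=
  ∃ u, Pr c u x

section basics
variable {X Y : Type*} [TopologicalSpace X] [TopologicalSpace Y]
variable {c c' : X → X → ZMod 2} {u u' : X → ZMod 2} {x : X}

theorem Pr.lc (h : Pr c u x) : LC c x := ⟨u, h⟩

theorem Pr.add (h : Pr c u x) (h' : Pr c' u' x) : Pr (c + c') (u + u') x := by
  obtain ⟨N, hN, h⟩ := h
  obtain ⟨N', hN', h'⟩ := h'
  refine ⟨N ∩ N', inter_mem hN hN', fun a ha b hb => ?_⟩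
  have h1 := h a ha.1 b hb.1
  have h2 := h' a ha.2 b hb.2
  simp only [Pi.add_apply]
  grind

theorem LC.add (h : LC c x) (h' : LC c' x) : LC (c + c') x := by
  obtain ⟨u, h⟩ := h
  obtain ⟨v, h'⟩ := h'
  exact ⟨_, h.add h'⟩

theorem Pr.zero : Pr (0 : X → X → ZMod 2) 0 x :=
  ⟨univ, univ_mem, fun a _ b _ => by simp⟩

theorem LC.zero : LC (0 : X → X → ZMod 2) x := ⟨0, Pr.zero⟩

theorem Pr.cob (u : X → ZMod 2) (x : X) : Pr (fun a b => u a + u b) u x :=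
  ⟨univ, univ_mem, fun a _ b _ => rfl⟩

theorem Pr.diag (h : Pr c u x) : c x x = 0 := by
  obtain ⟨N, hN, h⟩ := h
  rw [h x (mem_of_mem_nhds hN) x (mem_of_mem_nhds hN)]
  grind

theorem LC.diag (h : LC c x) : c x x = 0 := h.choose_spec.diag

theorem Pr.unique (h : Pr c u x) (h' : Pr c u' x) :
    ∀ᶠ a in 𝓝 x, u a + u' a = u x + u' x := by
  obtain ⟨N, hN, h⟩ := h
  obtain ⟨N', hN', h'⟩ := h'
  filter_upwards [hN, hN'] with a ha ha'
  have h1 := h a ha x (mem_of_mem_nhds hN)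
  have h2 := h' a ha' x (mem_of_mem_nhds hN')
  grind

theorem Pr.congr (h : Pr c u x) {k : ZMod 2} (hk : ∀ᶠ a in 𝓝 x, u' a = u a + k) :
    Pr c u' x := by
  obtain ⟨N, hN, h⟩ := h
  refine ⟨N ∩ {a | u' a = u a + k}, inter_mem hN hk, fun a ha b hb => ?_⟩
  have h1 := h a ha.1 b hb.1
  have h2 := ha.2
  have h3 := hb.2
  simp only [mem_ofPred_eq] at h2 h3
  grind

theorem Pr.congr0 (h : Pr c u x) (hk : ∀ᶠ a in 𝓝 x, u' a = u a) :
    Pr c u' x := h.congr (k := 0) (by simpa using hk)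

/-- local equality of cochains -/
theorem Pr.congrc (h : Pr c u x) {N : Set X} (hN : N ∈ 𝓝 x)
    (hk : ∀ a ∈ N, ∀ b ∈ N, c' a b = c a b) : Pr c' u x := by
  obtain ⟨N', hN', h⟩ := h
  refine ⟨N ∩ N', inter_mem hN hN', fun a ha b hb => ?_⟩
  rw [hk a ha.1 b hb.1, h a ha.2 b hb.2]

theorem Pr.eventually (h : Pr c u x) : ∀ᶠ y in 𝓝 x, Pr c u y := by
  obtain ⟨N, hN, h⟩ := h
  filter_upwards [eventually_mem_nhds_iff.2 hN] with y hy
  exact ⟨N, hy, h⟩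

theorem isOpen_pr (c : X → X → ZMod 2) (u : X → ZMod 2) : IsOpen {x | Pr c u x} := by
  rw [isOpen_iff_mem_nhds]
  intro x hx
  exact Pr.eventually hx

theorem isOpen_lc (c : X → X → ZMod 2) : IsOpen {x | LC c x} := by
  rw [isOpen_iff_mem_nhds]
  rintro x ⟨u, hx⟩
  exact hx.eventually.mono fun y hy => ⟨u, hy⟩

theorem Pr.comp {f : Y → X} {y : Y} (hf : ContinuousAt f y) (h : Pr c u (f y)) :
    Pr (fun a b => c (f a) (f b)) (u ∘ f) y := by
  obtain ⟨N, hN, h⟩ := h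
  exact ⟨f ⁻¹' N, hf hN, fun a ha b hb => h _ ha _ hb⟩

theorem LC.comp {f : Y → X} {y : Y} (hf : ContinuousAt f y) (h : LC c (f y)) :
    LC (fun a b => c (f a) (f b)) y := by
  obtain ⟨u, h⟩ := h
  exact ⟨_, h.comp hf⟩

/-- Primitive on `W` plus arbitrary correction to coboundary. -/
theorem Pr.addCob (h : Pr c u x) (v : X → ZMod 2) :
    Pr (fun a b => c a b + v a + v b) (u + v) x := by
  have := h.add (Pr.cob v x)
  refine this.congrc univ_mem fun a _ b _ => ?_
  simp only [Pi.add_apply]; ring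

/-- locally constant functions on preconnected sets -/
theorem const_of_loc {W : Set X} (hW : IsPreconnected W) {k : X → ZMod 2}
    (hk : ∀ y ∈ W, ∀ᶠ a in 𝓝 y, k a = k y) {a b : X} (ha : a ∈ W) (hb : b ∈ W) : k a = k b := by
  refine hW.induction₂ (fun a b => k a = k b) ?_ ?_ ?_ ha hb
  · intro y hy
    exact ((hk y hy).filter_mono nhdsWithin_le_nhds).mono fun a h => h.symm
  · intro _ _ _ _ _ _ h1 h2; exact h1.trans h2
  · intro _ _ _ _ h; exact h.symm

theorem Pr.const {W : Set X} (hW : IsPreconnected W) (h : ∀ y ∈ W, Pr c u y)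
    (h' : ∀ y ∈ W, Pr c u' y) {x0 : X} (hx0 : x0 ∈ W) :
    ∀ a ∈ W, u' a = u a + (u x0 + u' x0) := by
  intro a ha
  have := const_of_loc (k := fun a => u a + u' a) hW (fun y hy => (h y hy).unique (h' y hy)) ha hx0
  grind

theorem Pr.const' {W : Set X} (hW : IsPreconnected W) (h : ∀ y ∈ W, Pr c u y)
    (h' : ∀ y ∈ W, Pr c u' y) : ∃ k : ZMod 2, ∀ a ∈ W, u' a = u a + k := by
  rcases W.eq_empty_or_nonempty with rfl | ⟨x0, hx0⟩
  · exact ⟨0, by simp⟩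
  · exact ⟨_, Pr.const hW h h' hx0⟩

end basics

/-- Lemma A: cocycles on an interval have primitives. -/
theorem interval_prim (d : ℝ → ℝ → ZMod 2) (h : ∀ t ∈ Icc (0:ℝ) 1, LC d t) :
    ∃ u, ∀ t ∈ Icc (0:ℝ) 1, Pr d u t := by
  obtain ⟨t, ht0, htm, ⟨m, htm1⟩, ht⟩ :=
    exists_monotone_Icc_subset_open_cover_Icc (zero_le_one' ℝ)
      (c := fun u : ℝ → ZMod 2 => {s : Icc (0:ℝ) 1 | Pr d u s})
      (fun u => (isOpen_pr d u).preimage continuous_subtype_val)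
      (fun s _ => by
        obtain ⟨u, hu⟩ := h s s.2
        exact mem_iUnion.2 ⟨u, hu⟩)
  have key : ∀ n, ∃ u, ∀ s ∈ Icc (0:ℝ) (t n), Pr d u s := by
    intro n
    induction n with
    | zero =>
      obtain ⟨u, hu⟩ := h 0 (by simp)
      refine ⟨u, fun s hs => ?_⟩
      rw [ht0] at hs
      have : s = 0 := le_antisymm hs.2 hs.1
      rwa [this]
    | succ n ih =>
      obtain ⟨u, hu⟩ := ih
      obtain ⟨w, hw⟩ := ht n
      have hw' : ∀ s ∈ Icc (t n : ℝ) (t (n+1)), Pr d w s := by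
        intro s hs
        have hs1 : s ∈ Icc (0:ℝ) 1 := ⟨(t n).2.1.trans hs.1, hs.2.trans (t (n+1)).2.2⟩
        exact hw (show (⟨s, hs1⟩ : Icc (0:ℝ) 1) ∈ Icc (t n) (t (n+1)) from ⟨hs.1, hs.2⟩)
      have htn : (t n : ℝ) ≤ t (n+1) := htm (Nat.le_succ n)
      refine ⟨fun a => if a ≤ t n then u a else w a + (w (t n) + u (t n)), fun s hs => ?_⟩
      rcases lt_trichotomy s (t n) with hlt | heq | hgt
      · refine (hu s ⟨hs.1, hlt.le⟩).congr0 ?_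
        filter_upwards [eventually_lt_nhds hlt] with a ha
        simp [ha.le]
      · have h1 := hu s ⟨hs.1, heq.le⟩
        have h2 := hw' s ⟨heq.ge, heq.le.trans htn⟩
        have h3 := h1.unique h2
        refine h2.congr (k := w (t n) + u (t n)) ?_
        filter_upwards [h3] with a ha
        split_ifs with hh
        · rw [← heq]; grind
        · rfl
      · refine (hw' s ⟨hgt.le, hs.2⟩).congr (k := w (t n) + u (t n)) ?_
        filter_upwards [eventually_gt_nhds hgt] with a ha
        simp [not_le.2 ha]
  obtain ⟨u, hu⟩ := key m
  rw [htm1 m le_rfl] at hu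
  exact ⟨u, hu⟩

/-- Lemma B: cocycles on an open convex set have primitives. -/
theorem convex_prim {C : Set (ℝ × ℝ)} (hC : Convex ℝ C) (hCo : IsOpen C) (c : ℝ × ℝ → ℝ × ℝ → ZMod 2)
    (h : ∀ x ∈ C, LC c x) : ∃ u, ∀ x ∈ C, Pr c u x := by
  rcases C.eq_empty_or_nonempty with rfl | ⟨x0, hx0⟩
  · exact ⟨0, by simp⟩
  let g : ℝ × ℝ → ℝ → ℝ × ℝ := fun y t => x0 + t • (y - x0)
  have hgc : Continuous (fun p : (ℝ × ℝ) × ℝ => g p.1 p.2) := by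
    simp only [g]; fun_prop
  have hgy : ∀ y, Continuous (g y) := fun y => by simp only [g]; fun_prop
  have hgC : ∀ y ∈ C, ∀ t ∈ Icc (0:ℝ) 1, g y t ∈ C := by
    intro y hy t ht
    have := hC.add_smul_sub_mem hx0 hy ht
    simpa [g] using this
  have hex : ∀ y, ∃ U : ℝ → ZMod 2, y ∈ C →
      ∀ t ∈ Icc (0:ℝ) 1, Pr (fun a b => c (g y a) (g y b)) U t := by
    intro y
    by_cases hy : y ∈ C
    · obtain ⟨U, hU⟩ := interval_prim (fun a b => c (g y a) (g y b))
        (fun t ht => (h _ (hgC y hy t ht)).comp (hgy y).continuousAt)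
      exact ⟨U, fun _ => hU⟩
    · exact ⟨0, fun h => absurd h hy⟩
  choose U hU using hex
  refine ⟨fun y => U y 1 + U y 0, fun x hx => ?_⟩
  have tube : ∀ᶠ y in 𝓝 x, ∀ t ∈ Icc (0:ℝ) 1,
      ∃ N : Set (ℝ × ℝ), ∃ w : ℝ × ℝ → ZMod 2, (∀ a ∈ N, ∀ b ∈ N, c a b = w a + w b) ∧
        ∀ᶠ s in 𝓝 t, g x s ∈ N ∧ g y s ∈ N := by
    refine isCompact_Icc.eventually_forall_of_forall_eventually ?_
    intro t ht
    obtain ⟨w, N, hN, hw⟩ := h _ (hgC x hx t ht)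
    have e1 : ∀ᶠ p : (ℝ × ℝ) × ℝ in 𝓝 (x, t), g p.1 p.2 ∈ N :=
      (hgc.continuousAt (x := (x, t))) hN
    have e2 : ∀ᶠ p : (ℝ × ℝ) × ℝ in 𝓝 (x, t), g x p.2 ∈ N :=
      (((hgy x).comp continuous_snd).continuousAt (x := (x, t))) hN
    have e3 := (e2.and e1).eventually_nhds
    filter_upwards [e3] with p hp
    refine ⟨N, w, hw, ?_⟩
    have hcont : ContinuousAt (fun s : ℝ => (p.1, s)) p.2 := by fun_prop
    exact hcont.eventually (p := fun q : (ℝ × ℝ) × ℝ => g x q.2 ∈ N ∧ g q.1 q.2 ∈ N) hp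
  obtain ⟨w, N, hN, hw⟩ := h x hx
  have hg0 : ∀ y, g y 0 = x0 := fun y => by simp [g]
  have hg1 : ∀ y, g y 1 = y := fun y => by simp [g]
  have main : ∀ᶠ y in 𝓝 x, y ∈ C → c x y = (U x 1 + U x 0) + (U y 1 + U y 0) := by
    filter_upwards [tube] with y hy hyC
    have := const_of_loc (k := fun s => U x s + U y s + c (g x s) (g y s))
      (isPreconnected_Icc (a := (0:ℝ)) (b := 1)) ?_ (a := 1) (b := 0) (by simp) (by simp)
    · simp only [hg0, hg1, (h x0 hx0).diag] at this
      grind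
    · intro t ht
      obtain ⟨N, w, hw, hNt⟩ := hy t ht
      obtain ⟨M, hM, hUx⟩ := hU x hx t ht
      obtain ⟨M', hM', hUy⟩ := hU y hyC t ht
      have hNt' := hNt.self_of_nhds
      filter_upwards [hNt, hM, hM'] with s hs hsM hsM'
      have a1 := hUx s hsM t (mem_of_mem_nhds hM)
      have a2 := hUy s hsM' t (mem_of_mem_nhds hM')
      simp only at a1 a2
      rw [hw _ hs.1 _ hNt'.1] at a1
      rw [hw _ hs.2 _ hNt'.2] at a2
      rw [hw _ hs.1 _ hs.2, hw _ hNt'.1 _ hNt'.2]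
      grind
  refine ⟨N ∩ {y | y ∈ C ∧ (y ∈ C → c x y = (U x 1 + U x 0) + (U y 1 + U y 0))},
    inter_mem hN (inter_mem (hCo.mem_nhds hx) main), fun a ha b hb => ?_⟩
  have a1 := ha.2.2 ha.2.1
  have a2 := hb.2.2 hb.2.1
  rw [hw x (mem_of_mem_nhds hN) _ ha.1] at a1
  rw [hw x (mem_of_mem_nhds hN) _ hb.1] at a2
  rw [hw _ ha.1 _ hb.1]
  grind

end EG
end
section
open Set Filter Topology

namespace EG

def HE : Set (ℝ × ℝ) := {p | 0 < p.1}
def HN : Set (ℝ × ℝ) := {p | 0 < p.2}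
def HW : Set (ℝ × ℝ) := {p | p.1 < 0}
def HS : Set (ℝ × ℝ) := {p | p.2 < 0}

theorem isOpen_HE : IsOpen HE := isOpen_lt continuous_const continuous_fst
theorem isOpen_HN : IsOpen HN := isOpen_lt continuous_const continuous_snd
theorem isOpen_HW : IsOpen HW := isOpen_lt continuous_fst continuous_const
theorem isOpen_HS : IsOpen HS := isOpen_lt continuous_snd continuous_const

theorem convex_HE : Convex ℝ HE := convex_halfSpace_gt (f := Prod.fst) (LinearMap.fst ℝ ℝ ℝ).isLinear 0
theorem convex_HN : Convex ℝ HN := convex_halfSpace_gt (f := Prod.snd) (LinearMap.snd ℝ ℝ ℝ).isLinear 0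
theorem convex_HW : Convex ℝ HW := convex_halfSpace_lt (f := Prod.fst) (LinearMap.fst ℝ ℝ ℝ).isLinear 0
theorem convex_HS : Convex ℝ HS := convex_halfSpace_lt (f := Prod.snd) (LinearMap.snd ℝ ℝ ℝ).isLinear 0

structure Quad (c : ℝ × ℝ → ℝ × ℝ → ZMod 2) (C : Set (ℝ × ℝ)) (uE uN uW uS : ℝ × ℝ → ZMod 2)
    (d : ZMod 2) : Prop where
  pE : ∀ a ∈ C ∩ HE, Pr c uE a
  pN : ∀ a ∈ C ∩ HN, Pr c uN a
  pW : ∀ a ∈ C ∩ HW, Pr c uW a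
  pS : ∀ a ∈ C ∩ HS, Pr c uS a
  eEN : ∀ a ∈ C ∩ (HE ∩ HN), uN a = uE a
  eNW : ∀ a ∈ C ∩ (HN ∩ HW), uW a = uN a
  eWS : ∀ a ∈ C ∩ (HW ∩ HS), uS a = uW a
  eSE : ∀ a ∈ C ∩ (HS ∩ HE), uE a = uS a + d

theorem quad_exists {C : Set (ℝ × ℝ)} (hC : Convex ℝ C) (hCo : IsOpen C)
    (c : ℝ × ℝ → ℝ × ℝ → ZMod 2) (h : ∀ y ∈ C, y ≠ 0 → LC c y) :
    ∃ uE uN uW uS d, Quad c C uE uN uW uS d := by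
  have nz : ∀ y : ℝ × ℝ, (y ∈ HE ∨ y ∈ HN ∨ y ∈ HW ∨ y ∈ HS) → y ≠ 0 := by
    rintro y hy rfl
    simp [HE, HN, HW, HS] at hy
  obtain ⟨uE, hE⟩ := convex_prim (hC.inter convex_HE) (hCo.inter isOpen_HE) c
    (fun y hy => h y hy.1 (nz y (by simp [hy.2])))
  obtain ⟨uN, hN⟩ := convex_prim (hC.inter convex_HN) (hCo.inter isOpen_HN) c
    (fun y hy => h y hy.1 (nz y (by simp [hy.2])))
  obtain ⟨uW, hW⟩ := convex_prim (hC.inter convex_HW) (hCo.inter isOpen_HW) c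
    (fun y hy => h y hy.1 (nz y (by simp [hy.2])))
  obtain ⟨uS, hS⟩ := convex_prim (hC.inter convex_HS) (hCo.inter isOpen_HS) c
    (fun y hy => h y hy.1 (nz y (by simp [hy.2])))
  obtain ⟨k1, h1⟩ := Pr.const' (c := c) (u := uE) (u' := uN)
    (hC.inter (convex_HE.inter convex_HN)).isPreconnected
    (fun y hy => hE y ⟨hy.1, hy.2.1⟩) (fun y hy => hN y ⟨hy.1, hy.2.2⟩)
  obtain ⟨k2, h2⟩ := Pr.const' (c := c) (u := uN) (u' := uW)
    (hC.inter (convex_HN.inter convex_HW)).isPreconnected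
    (fun y hy => hN y ⟨hy.1, hy.2.1⟩) (fun y hy => hW y ⟨hy.1, hy.2.2⟩)
  obtain ⟨k3, h3⟩ := Pr.const' (c := c) (u := uW) (u' := uS)
    (hC.inter (convex_HW.inter convex_HS)).isPreconnected
    (fun y hy => hW y ⟨hy.1, hy.2.1⟩) (fun y hy => hS y ⟨hy.1, hy.2.2⟩)
  obtain ⟨k4, h4⟩ := Pr.const' (c := c) (u := uS) (u' := uE)
    (hC.inter (convex_HS.inter convex_HE)).isPreconnected
    (fun y hy => hS y ⟨hy.1, hy.2.1⟩) (fun y hy => hE y ⟨hy.1, hy.2.2⟩)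
  refine ⟨uE, fun a => uN a + k1, fun a => uW a + (k1 + k2), fun a => uS a + (k1 + k2 + k3),
    k1 + k2 + k3 + k4, hE, fun a ha => (hN a ha).congr (Eventually.of_forall fun _ => rfl),
    fun a ha => (hW a ha).congr (Eventually.of_forall fun _ => rfl),
    fun a ha => (hS a ha).congr (Eventually.of_forall fun _ => rfl), ?_, ?_, ?_, ?_⟩
  · intro a ha; have := h1 a ha; grind
  · intro a ha; have := h2 a ha; grind
  · intro a ha; have := h3 a ha; grind
  · intro a ha; have := h4 a ha; grind

theorem Quad.glue {c : ℝ × ℝ → ℝ × ℝ → ZMod 2} {C : Set (ℝ × ℝ)} (hCo : IsOpen C)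
    {uE uN uW uS : ℝ × ℝ → ZMod 2} (q : Quad c C uE uN uW uS 0) :
    ∃ u, (∀ y ∈ C, y ≠ 0 → Pr c u y) ∧
      ∀ a, (a ∈ HE ∧ u a = uE a) ∨ (a ∈ HN ∧ u a = uN a) ∨ (a ∈ HW ∧ u a = uW a) ∨
        (a ∈ HS ∧ u a = uS a) ∨ a = 0 := by
  classical
  refine ⟨fun a => if 0 < a.1 then uE a else if a.1 < 0 then uW a else
    if 0 < a.2 then uN a else uS a, ?_, ?_⟩
  · intro y hy hy0
    rcases lt_trichotomy y.1 0 with h1 | h1 | h1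
    · refine (q.pW y ⟨hy, h1⟩).congr0 ?_
      filter_upwards [isOpen_HW.mem_nhds h1] with a ha
      have ha : a.1 < 0 := ha
      simp [ha, not_lt.2 ha.le]
    · rcases lt_trichotomy y.2 0 with h2 | h2 | h2
      · refine (q.pS y ⟨hy, h2⟩).congr0 ?_
        filter_upwards [isOpen_HS.mem_nhds h2, hCo.mem_nhds hy] with a ha haC
        have ha' : a.2 < 0 := ha
        split_ifs with i1 i2 i3
        · have := q.eSE a ⟨haC, ha, i1⟩; simpa using this
        · exact (q.eWS a ⟨haC, i2, ha⟩).symm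
        · exact absurd i3 (not_lt.2 ha'.le)
        · rfl
      · exact absurd (Prod.ext h1 h2) hy0
      · refine (q.pN y ⟨hy, h2⟩).congr0 ?_
        filter_upwards [isOpen_HN.mem_nhds h2, hCo.mem_nhds hy] with a ha haC
        have ha' : 0 < a.2 := ha
        split_ifs with i1 i2
        · exact (q.eEN a ⟨haC, i1, ha⟩).symm
        · exact q.eNW a ⟨haC, ha, i2⟩
        · rfl
    · refine (q.pE y ⟨hy, h1⟩).congr0 ?_
      filter_upwards [isOpen_HE.mem_nhds h1] with a ha
      have ha : 0 < a.1 := ha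
      simp [ha]
  · intro a
    rcases lt_trichotomy a.1 0 with h1 | h1 | h1
    · right; right; left
      exact ⟨h1, by simp [h1, not_lt.2 h1.le]⟩
    · rcases lt_trichotomy a.2 0 with h2 | h2 | h2
      · right; right; right; left
        exact ⟨h2, by simp [h1, not_lt.2 h2.le]⟩
      · right; right; right; right
        exact Prod.ext h1 h2
      · right; left
        exact ⟨h2, by simp [h1, h2]⟩
    · left
      exact ⟨h1, by simp [h1]⟩

/-- `H¹` of a punctured convex set has at most two elements. -/
theorem plane_codim {C : Set (ℝ × ℝ)} (hC : Convex ℝ C) (hCo : IsOpen C)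
    (c c' : ℝ × ℝ → ℝ × ℝ → ZMod 2) (h : ∀ y ∈ C, y ≠ 0 → LC c y)
    (h' : ∀ y ∈ C, y ≠ 0 → LC c' y) :
    (∃ u, ∀ y ∈ C, y ≠ 0 → Pr c u y) ∨ (∃ u, ∀ y ∈ C, y ≠ 0 → Pr c' u y) ∨
      (∃ u, ∀ y ∈ C, y ≠ 0 → Pr (c + c') u y) := by
  obtain ⟨uE, uN, uW, uS, d, q⟩ := quad_exists hC hCo c h
  obtain ⟨vE, vN, vW, vS, d', q'⟩ := quad_exists hC hCo c' h'
  by_cases hd : d = 0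
  · subst hd
    obtain ⟨u, hu, -⟩ := q.glue hCo
    exact Or.inl ⟨u, hu⟩
  by_cases hd' : d' = 0
  · subst hd'
    obtain ⟨u, hu, -⟩ := q'.glue hCo
    exact Or.inr (Or.inl ⟨u, hu⟩)
  have hdd : d + d' = 0 := by clear q q'; revert d d'; decide
  have Q : Quad (c + c') C (uE + vE) (uN + vN) (uW + vW) (uS + vS) 0 := by
    refine ⟨fun a ha => (q.pE a ha).add (q'.pE a ha), fun a ha => (q.pN a ha).add (q'.pN a ha),
      fun a ha => (q.pW a ha).add (q'.pW a ha), fun a ha => (q.pS a ha).add (q'.pS a ha),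
      ?_, ?_, ?_, ?_⟩
    · intro a ha; simp [q.eEN a ha, q'.eEN a ha]
    · intro a ha; simp [q.eNW a ha, q'.eNW a ha]
    · intro a ha; simp [q.eWS a ha, q'.eWS a ha]
    · intro a ha; simp only [Pi.add_apply, q.eSE a ha, q'.eSE a ha]; grind
  obtain ⟨u, hu, -⟩ := Q.glue hCo
  exact Or.inr (Or.inr ⟨u, hu⟩)

/-- outer region -/
def Out (R : ℝ) : Set (ℝ × ℝ) := {p | R < |p.1| ∨ R < |p.2|}

theorem outE (R : ℝ) (hR : 0 ≤ R) : IsPreconnected (HE ∩ Out R) := by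
  have e : HE ∩ Out R = ((Ioi 0 ×ˢ Ioi R) ∪ (Ioi R ×ˢ univ)) ∪ (Ioi 0 ×ˢ Iio (-R)) := by
    ext ⟨a, b⟩
    simp only [HE, Out, mem_inter_iff, mem_ofPred_eq, mem_union, mem_prod, mem_Ioi, mem_univ,
      mem_Iio, lt_abs]
    constructor
    · rintro ⟨h, (h1 | h1) | (h1 | h1)⟩
      · simp [h1]
      · linarith
      · simp [h, h1]
      · right; constructor <;> linarith
    · rintro ((⟨h, h1⟩ | ⟨h, -⟩) | ⟨h, h1⟩)
      · exact ⟨h, Or.inr (Or.inl h1)⟩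
      · exact ⟨by linarith, Or.inl (Or.inl h)⟩
      · exact ⟨h, Or.inr (Or.inr (by linarith))⟩
  rw [e]
  refine IsPreconnected.union (R + 1, -R - 1) (Or.inr ⟨by simp, by simp⟩)
    ⟨by simp; linarith, by simp⟩ ?_ (isPreconnected_Ioi.prod isPreconnected_Iio)
  exact IsPreconnected.union (R + 1, R + 1) ⟨by simp; linarith, by simp⟩
    ⟨by simp, by simp⟩ (isPreconnected_Ioi.prod isPreconnected_Ioi)
    (isPreconnected_Ioi.prod isPreconnected_univ)

theorem outN (R : ℝ) (hR : 0 ≤ R) : IsPreconnected (HN ∩ Out R) := by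
  have : HN ∩ Out R = Prod.swap '' (HE ∩ Out R) := by
    rw [image_swap_eq_preimage_swap]
    ext ⟨a, b⟩
    simp [HN, HE, Out, or_comm]
  rw [this]
  exact (outE R hR).image _ continuous_swap.continuousOn

theorem outW (R : ℝ) (hR : 0 ≤ R) : IsPreconnected (HW ∩ Out R) := by
  have : HW ∩ Out R = (fun p => -p) '' (HE ∩ Out R) := by
    rw [image_neg_eq_neg]
    ext ⟨a, b⟩
    simp [HW, HE, Out]
  rw [this]
  exact (outE R hR).image _ continuous_neg.continuousOn

theorem outS (R : ℝ) (hR : 0 ≤ R) : IsPreconnected (HS ∩ Out R) := by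
  have : HS ∩ Out R = (fun p => -p) '' (HN ∩ Out R) := by
    rw [image_neg_eq_neg]
    ext ⟨a, b⟩
    simp [HN, HS, Out]
  rw [this]
  exact (outN R hR).image _ continuous_neg.continuousOn

theorem half_prim {H : Set (ℝ × ℝ)} (hH : Convex ℝ H) (hHo : IsOpen H) (h0 : (0 : ℝ × ℝ) ∉ H)
    {R : ℝ} (hpc : IsPreconnected (H ∩ Out R)) (c : ℝ × ℝ → ℝ × ℝ → ZMod 2)
    (h : ∀ y, y ≠ 0 → LC c y) (u : ℝ × ℝ → ZMod 2) (hu : ∀ y ∈ Out R, Pr c u y) :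
    ∃ v, (∀ y ∈ H, Pr c v y) ∧ ∀ y ∈ H ∩ Out R, v y = u y := by
  obtain ⟨v, hv⟩ := convex_prim hH hHo c (fun y hy => h y (by rintro rfl; exact h0 hy))
  obtain ⟨k, hk⟩ := Pr.const' hpc (fun y hy => hv y hy.1) (fun y hy => hu y hy.2)
  exact ⟨fun a => v a + k, fun y hy => (hv y hy).congr (Eventually.of_forall fun _ => rfl),
    fun y hy => (hk y hy).symm⟩

/-- A cocycle on the punctured plane with a primitive near infinity. -/
theorem plane_ext (R : ℝ) (hR : 0 ≤ R) (c : ℝ × ℝ → ℝ × ℝ → ZMod 2)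
    (h : ∀ y, y ≠ 0 → LC c y) (u : ℝ × ℝ → ZMod 2) (hu : ∀ y ∈ Out R, Pr c u y) :
    ∃ v, (∀ y, y ≠ 0 → Pr c v y) ∧ ∀ y ∈ Out R, v y = u y := by
  obtain ⟨vE, hE, eE⟩ := half_prim convex_HE isOpen_HE (by simp [HE]) (outE R hR) c h u hu
  obtain ⟨vN, hN, eN⟩ := half_prim convex_HN isOpen_HN (by simp [HN]) (outN R hR) c h u hu
  obtain ⟨vW, hW, eW⟩ := half_prim convex_HW isOpen_HW (by simp [HW]) (outW R hR) c h u hu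
  obtain ⟨vS, hS, eS⟩ := half_prim convex_HS isOpen_HS (by simp [HS]) (outS R hR) c h u hu
  have hR1 : R < |R + 1| := by rw [abs_of_pos (by linarith)]; linarith
  have hR2 : R < |-(R + 1)| := by rw [abs_neg]; exact hR1
  have key : ∀ {H H' : Set (ℝ × ℝ)} {v v' : ℝ × ℝ → ZMod 2} (_ : Convex ℝ H) (_ : Convex ℝ H')
      (_ : ∀ y ∈ H, Pr c v y) (_ : ∀ y ∈ H', Pr c v' y) (_ : ∀ y ∈ H ∩ Out R, v y = u y)
      (_ : ∀ y ∈ H' ∩ Out R, v' y = u y) (p : ℝ × ℝ) (_ : p ∈ H) (_ : p ∈ H') (_ : p ∈ Out R),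
      ∀ a ∈ univ ∩ (H ∩ H'), v' a = v a := by
    intro H H' v v' cH cH' h1 h2 h3 h4 p p1 p2 p3 a ha
    have := Pr.const (c := c) (u := v) (u' := v') (cH.inter cH').isPreconnected
      (fun y hy => h1 y hy.1) (fun y hy => h2 y hy.2) (x0 := p) ⟨p1, p2⟩ a ha.2
    rw [this, h3 p ⟨p1, p3⟩, h4 p ⟨p2, p3⟩]
    grind
  have q : Quad c univ vE vN vW vS 0 := by
    refine ⟨fun a ha => hE a ha.2, fun a ha => hN a ha.2, fun a ha => hW a ha.2,
      fun a ha => hS a ha.2, ?_, ?_, ?_, ?_⟩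
    · exact key convex_HE convex_HN hE hN eE eN (R + 1, R + 1) (by simp [HE]; linarith)
        (by simp [HN]; linarith) (Or.inl hR1)
    · exact key convex_HN convex_HW hN hW eN eW (-(R + 1), R + 1) (by simp [HN]; linarith)
        (by simp [HW]; linarith) (Or.inl hR2)
    · exact key convex_HW convex_HS hW hS eW eS (-(R + 1), -(R + 1)) (by simp [HW]; linarith)
        (by simp [HS]; linarith) (Or.inl hR2)
    · intro a ha
      rw [add_zero]
      exact key convex_HS convex_HE hS hE eS eE (R + 1, -(R + 1)) (by simp [HS]; linarith)
        (by simp [HE]; linarith) (Or.inl hR1) a ha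
  obtain ⟨v, hv, hv'⟩ := q.glue isOpen_univ
  refine ⟨v, fun y hy => hv y (mem_univ _) hy, fun y hy => ?_⟩
  rcases hv' y with ⟨h1, h2⟩ | ⟨h1, h2⟩ | ⟨h1, h2⟩ | ⟨h1, h2⟩ | h1
  · rw [h2, eE y ⟨h1, hy⟩]
  · rw [h2, eN y ⟨h1, hy⟩]
  · rw [h2, eW y ⟨h1, hy⟩]
  · rw [h2, eS y ⟨h1, hy⟩]
  · subst h1
    simp [Out] at hy
    linarith

end EG
end
section
open Set Filter Topology

namespace EG

/-- symmetrised cochain -/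
noncomputable def hat {X : Type*} (c : X → X → ZMod 2) (a b : X) : ZMod 2 := by
  classical exact if a = b then 0 else c a b * c b a

theorem hat_self {X : Type*} (c : X → X → ZMod 2) (a : X) : hat c a a = 0 := by simp [hat]

theorem hat_comm {X : Type*} (c : X → X → ZMod 2) (a b : X) : hat c a b = hat c b a := by
  unfold hat
  by_cases h : a = b
  · simp [h]
  · simp [h, Ne.symm h, mul_comm]

theorem hat_eq {X : Type*} (c : X → X → ZMod 2) {w : X → ZMod 2} {a b : X}
    (h : c a b = w a + w b) (h' : c b a = w b + w a) : hat c a b = w a + w b := by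
  unfold hat
  by_cases hab : a = b
  · subst hab; simp; grind
  · simp only [hab, if_false, h, h']
    generalize w a = p
    generalize w b = q
    revert p q; decide

theorem hat_supp {X : Type*} (c : X → X → ZMod 2) {a b : X} (h : hat c a b ≠ 0) : c a b ≠ 0 := by
  unfold hat at h
  intro h0
  simp [h0] at h

/-- grid map -/
noncomputable def sg (e : ℝ) (p : ℝ × ℝ) : ℝ × ℝ := (e * ⌊p.1 / e⌋, e * ⌊p.2 / e⌋)

theorem sg_dist {e : ℝ} (he : 0 < e) (p : ℝ × ℝ) : dist (sg e p) p ≤ e := by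
  have key : ∀ x : ℝ, dist (e * ⌊x / e⌋) x ≤ e := by
    intro x
    have h1 := Int.floor_le (x / e)
    have h2 := Int.lt_floor_add_one (x / e)
    rw [le_div_iff₀ he] at h1
    rw [div_lt_iff₀ he] at h2
    rw [Real.dist_eq, abs_le]
    constructor <;> nlinarith
  rw [Prod.dist_eq]
  exact max_le (key _) (key _)

/-- floor takes locally at most two values -/
theorem floor_near (e : ℝ) (x : ℝ) :
    ∀ᶠ a in 𝓝 x, ⌊a / e⌋ = ⌊x / e⌋ ∨ ⌊a / e⌋ = ⌊x / e⌋ - 1 := by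
  have hc : ContinuousAt (fun a : ℝ => a / e) x := by fun_prop
  have h1 : (⌊x / e⌋ : ℝ) - 1 < x / e := by linarith [Int.floor_le (x / e)]
  have h2 := Int.lt_floor_add_one (x / e)
  filter_upwards [hc.eventually (eventually_gt_nhds h1), hc.eventually (eventually_lt_nhds h2)]
    with a ha hb
  have i1 : ⌊x / e⌋ - 1 ≤ ⌊a / e⌋ := by
    rw [Int.le_floor]; push_cast; exact ha.le
  have i2 : ⌊a / e⌋ < ⌊x / e⌋ + 1 := by
    rw [Int.floor_lt]; push_cast; exact hb
  omega

theorem floor_const (e : ℝ) (x : ℝ) (hx : (⌊x / e⌋ : ℝ) ≠ x / e) :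
    ∀ᶠ a in 𝓝 x, ⌊a / e⌋ = ⌊x / e⌋ := by
  have hc : ContinuousAt (fun a : ℝ => a / e) x := by fun_prop
  have h1 : (⌊x / e⌋ : ℝ) < x / e := lt_of_le_of_ne (Int.floor_le (x / e)) hx
  have h2 := Int.lt_floor_add_one (x / e)
  filter_upwards [hc.eventually (eventually_gt_nhds h1), hc.eventually (eventually_lt_nhds h2)]
    with a ha hb
  rw [Int.floor_eq_iff]
  exact ⟨ha.le, hb⟩

theorem sg_near (e : ℝ) (he : 0 < e) (z : ℝ × ℝ) (hz : sg e z ≠ z) :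
    ∃ p, ∀ᶠ a in 𝓝 z, sg e a = sg e z ∨ sg e a = p := by
  have hz' : (⌊z.1 / e⌋ : ℝ) ≠ z.1 / e ∨ (⌊z.2 / e⌋ : ℝ) ≠ z.2 / e := by
    by_contra! h
    apply hz
    simp only [sg]
    rw [h.1, h.2]
    ext <;> simp <;> field_simp
  have c1 : ContinuousAt (Prod.fst : ℝ × ℝ → ℝ) z := continuousAt_fst
  have c2 : ContinuousAt (Prod.snd : ℝ × ℝ → ℝ) z := continuousAt_snd
  rcases hz' with h | h
  · refine ⟨(e * ⌊z.1 / e⌋, e * ((⌊z.2 / e⌋ - 1 : ℤ) : ℝ)), ?_⟩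
    filter_upwards [c1.eventually (floor_const e _ h), c2.eventually (floor_near e z.2)] with a h1 h2
    simp only [sg, h1]
    rcases h2 with h2 | h2 <;> simp [h2]
  · refine ⟨(e * ((⌊z.1 / e⌋ - 1 : ℤ) : ℝ), e * ⌊z.2 / e⌋), ?_⟩
    filter_upwards [c2.eventually (floor_const e _ h), c1.eventually (floor_near e z.1)] with a h1 h2
    simp only [sg, h1]
    rcases h2 with h2 | h2 <;> simp [h2]

theorem grid_finite (e : ℝ) (he : 0 < e) (R : ℝ) :
    ({z | sg e z = z} ∩ Metric.closedBall (0 : ℝ × ℝ) R).Finite := by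
  let m : ℤ := ⌈R / e⌉
  refine Set.Finite.subset ((((Set.finite_Icc (-m) m).prod (Set.finite_Icc (-m) m))).image
    (fun q : ℤ × ℤ => ((e * q.1 : ℝ), (e * q.2 : ℝ)))) ?_
  rintro z ⟨hz, hzR⟩
  have hz : sg e z = z := hz
  rw [mem_closedBall_zero_iff, Prod.norm_def, max_le_iff, Real.norm_eq_abs, Real.norm_eq_abs] at hzR
  have key : ∀ x : ℝ, |x| ≤ R → ⌊x / e⌋ ∈ Icc (-m) m := by
    intro x hx
    rw [abs_le] at hx
    have hm : R / e ≤ m := Int.le_ceil _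
    rw [div_le_iff₀ he] at hm
    constructor
    · rw [Int.le_floor, le_div_iff₀ he]
      push_cast; nlinarith
    · have h1 := Int.floor_le (x / e)
      rw [le_div_iff₀ he] at h1
      by_contra hcon
      push Not at hcon
      have : (m : ℝ) + 1 ≤ ⌊x / e⌋ := by exact_mod_cast hcon
      nlinarith
  exact ⟨(⌊z.1 / e⌋, ⌊z.2 / e⌋), ⟨key _ hzR.1, key _ hzR.2⟩, hz⟩

/-- Extension lemma: a cocycle near a closed set of the plane extends to the complement
of a finite set. -/
theorem plane_grid (c : ℝ × ℝ → ℝ × ℝ → ZMod 2) (M : Set (ℝ × ℝ)) (hM : IsClosed M)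
    (hLC : ∀ y ∈ M, LC c y) (R : ℝ)
    (hs : ∀ a b, c a b ≠ 0 → a ∈ Metric.closedBall (0 : ℝ × ℝ) R ∧
      b ∈ Metric.closedBall (0 : ℝ × ℝ) R) :
    ∃ (c' : ℝ × ℝ → ℝ × ℝ → ZMod 2) (w : ℝ × ℝ → ZMod 2) (Q : Set (ℝ × ℝ)), Q.Finite ∧
      Disjoint Q M ∧ (∀ y ∉ Q, LC c' y) ∧
      (∀ a b, c' a b ≠ 0 → a ∈ Metric.closedBall (0 : ℝ × ℝ) (R + 1) ∧
        b ∈ Metric.closedBall (0 : ℝ × ℝ) (R + 1)) ∧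
      (∀ y ∈ M, Pr (c + c') w y) ∧ (∀ a, w a ≠ 0 → a ∈ Metric.closedBall (0 : ℝ × ℝ) R) := by
  obtain ⟨d, hd, hdK⟩ := lebesgue_number_lemma_of_metric
    (c := fun p : {p : Set (ℝ × ℝ) × (ℝ × ℝ → ZMod 2) //
      IsOpen p.1 ∧ ∀ a ∈ p.1, ∀ b ∈ p.1, c a b = p.2 a + p.2 b} => p.1.1)
    ((isCompact_closedBall (0 : ℝ × ℝ) (R + 1)).inter_right hM) (fun p => p.2.1)
    (by
      rintro y ⟨-, hy⟩
      obtain ⟨u, N, hN, hu⟩ := hLC y hy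
      obtain ⟨O, hON, hO, hyO⟩ := mem_nhds_iff.1 hN
      exact mem_iUnion.2 ⟨⟨(O, u), hO, fun a ha b hb => hu a (hON ha) b (hON hb)⟩, hyO⟩)
  let e : ℝ := min (d / 4) (1 / 4)
  have he : 0 < e := by positivity
  have he1 : e ≤ 1 / 4 := min_le_right _ _
  have he2 : e ≤ d / 4 := min_le_left _ _
  have loc : ∀ y ∈ M, ∃ u : ℝ × ℝ → ZMod 2, ∀ a ∈ Metric.ball y (3 * e),
      ∀ b ∈ Metric.ball y (3 * e), c a b = u a + u b := by
    intro y hy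
    by_cases hyR : y ∈ Metric.closedBall (0 : ℝ × ℝ) (R + 1)
    · obtain ⟨⟨⟨O, u⟩, hO, hu⟩, hsub⟩ := hdK y ⟨hyR, hy⟩
      have : Metric.ball y (3 * e) ⊆ Metric.ball y d := Metric.ball_subset_ball (by linarith)
      exact ⟨u, fun a ha b hb => hu a (hsub (this ha)) b (hsub (this hb))⟩
    · refine ⟨0, fun a ha b hb => ?_⟩
      by_contra hne
      have h1 := (hs a b (by simpa using hne)).1
      apply hyR
      rw [Metric.mem_closedBall] at h1 ⊢
      rw [Metric.mem_ball] at ha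
      have := dist_triangle_left y 0 a
      linarith
  have loc' : ∀ y ∈ M, ∃ u : ℝ × ℝ → ZMod 2, ∀ a ∈ Metric.ball y e, ∀ b ∈ Metric.ball y e,
      c a b = u a + u b ∧ c a (sg e a) = u a + u (sg e a) ∧ c b (sg e b) = u b + u (sg e b) ∧
      hat c (sg e a) (sg e b) = u (sg e a) + u (sg e b) := by
    intro y hy
    obtain ⟨u, hu⟩ := loc y hy
    have s1 : ∀ a ∈ Metric.ball y e, a ∈ Metric.ball y (3 * e) := fun a ha =>
      Metric.ball_subset_ball (by linarith) ha
    have s2 : ∀ a ∈ Metric.ball y e, sg e a ∈ Metric.ball y (3 * e) := fun a ha => by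
      rw [Metric.mem_ball] at ha ⊢
      have := dist_triangle (sg e a) a y
      have := sg_dist he a
      linarith
    refine ⟨u, fun a ha b hb => ⟨hu _ (s1 a ha) _ (s1 b hb), hu _ (s1 a ha) _ (s2 a ha),
      hu _ (s1 b hb) _ (s2 b hb), hat_eq c (hu _ (s2 a ha) _ (s2 b hb))
      (hu _ (s2 b hb) _ (s2 a ha))⟩⟩
  let c' : ℝ × ℝ → ℝ × ℝ → ZMod 2 := fun a b => hat c (sg e a) (sg e b)
  have hsupp : ∀ a b, c' a b ≠ 0 → a ∈ Metric.closedBall (0 : ℝ × ℝ) (R + 1) ∧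
        b ∈ Metric.closedBall (0 : ℝ × ℝ) (R + 1) := by
    intro a b hab
    obtain ⟨h1, h2⟩ := hs _ _ (hat_supp c hab)
    rw [Metric.mem_closedBall] at h1 h2
    constructor
    · rw [Metric.mem_closedBall]
      have := dist_triangle_left a 0 (sg e a)
      have := sg_dist he a
      linarith
    · rw [Metric.mem_closedBall]
      have := dist_triangle_left b 0 (sg e b)
      have := sg_dist he b
      linarith
  have hcM : ∀ y ∈ M, Pr (c + c') (fun a => c a (sg e a)) y := by
    intro y hy
    obtain ⟨u, hu⟩ := loc' y hy
    refine ⟨Metric.ball y e, Metric.ball_mem_nhds y he, fun a ha b hb => ?_⟩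
    obtain ⟨h1, h2, h3, h4⟩ := hu a ha b hb
    simp only [Pi.add_apply, c']
    rw [h1, h2, h3, h4]
    ring
  have hcM' : ∀ y ∈ M, LC c' y := by
    intro y hy
    have := (LC.add ⟨_, hcM y hy⟩ (hLC y hy))
    obtain ⟨u, hu⟩ := this
    refine ⟨u, hu.congrc univ_mem fun a _ b _ => ?_⟩
    simp only [Pi.add_apply]; grind
  refine ⟨c', fun a => c a (sg e a), {y | ¬ LC c' y}, ?_, ?_, ?_, hsupp, hcM, ?_⟩
  · refine (grid_finite e he (R + 1)).subset ?_
    intro z hz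
    have hz : ¬ LC c' z := hz
    constructor
    · by_contra hne
      apply hz
      obtain ⟨p, hp⟩ := sg_near e he z hne
      refine ⟨fun a => hat c (sg e a) (sg e z), _, hp, fun a ha b hb => ?_⟩
      simp only [c']
      rcases ha with ha | ha <;> rcases hb with hb | hb <;> rw [ha, hb]
      · simp [hat_self]
      · rw [hat_self, zero_add, hat_comm]
      · rw [hat_self, add_zero]
      · rw [hat_self]; grind
    · by_contra hne
      apply hz
      refine ⟨0, (Metric.closedBall (0 : ℝ × ℝ) (R + 1))ᶜ,
        Metric.isClosed_closedBall.isOpen_compl.mem_nhds hne, fun a ha b hb => ?_⟩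
      by_contra h0
      exact ha (hsupp a b (by simpa using h0)).1
  · rw [Set.disjoint_left]
    intro y hy hyM
    exact hy (hcM' y hyM)
  · intro y hy
    simpa using hy
  · intro a ha
    exact (hs _ _ ha).1

end EG
end
section
open Set Filter Topology
namespace EG

/-- local equality of cochains at a point -/
def Leq {X : Type*} [TopologicalSpace X] (c c' : X → X → ZMod 2) (y : X) : Prop :=
  ∃ N ∈ 𝓝 y, ∀ a ∈ N, ∀ b ∈ N, c a b = c' a b

/-- `c` is exact on a punctured neighbourhood of `q`. -/
def EX {X : Type*} [TopologicalSpace X] (c : X → X → ZMod 2) (q : X) : Prop :=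
  ∃ u, ∀ᶠ y in 𝓝[≠] q, Pr c u y

section basics
variable {X Y : Type*} [TopologicalSpace X] [TopologicalSpace Y]
variable {c c' c'' : X → X → ZMod 2} {u u' : X → ZMod 2} {x q : X}

theorem Leq.refl (c : X → X → ZMod 2) (x : X) : Leq c c x := ⟨univ, univ_mem, by simp⟩

theorem Leq.symm (h : Leq c c' x) : Leq c' c x := by
  obtain ⟨N, hN, h⟩ := h
  exact ⟨N, hN, fun a ha b hb => (h a ha b hb).symm⟩

theorem Leq.trans (h : Leq c c' x) (h' : Leq c' c'' x) : Leq c c'' x := by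
  obtain ⟨N, hN, h⟩ := h
  obtain ⟨N', hN', h'⟩ := h'
  exact ⟨N ∩ N', inter_mem hN hN',
    fun a ha b hb => (h a ha.1 b hb.1).trans (h' a ha.2 b hb.2)⟩

theorem Leq.pr (h : Leq c c' x) (hp : Pr c' u x) : Pr c u x := by
  obtain ⟨N, hN, h⟩ := h
  exact hp.congrc hN h

theorem Leq.lc (h : Leq c c' x) (hp : LC c' x) : LC c x := by
  obtain ⟨u, hp⟩ := hp
  exact ⟨u, h.pr hp⟩

theorem Leq.add_zero (h : Pr c' 0 x) : Leq (c + c') c x := by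
  obtain ⟨N, hN, h⟩ := h
  refine ⟨N, hN, fun a ha b hb => ?_⟩
  simp [h a ha b hb]

theorem addself (c : X → X → ZMod 2) : c + c = 0 := by
  funext a b; simp only [Pi.add_apply, Pi.zero_apply]; grind

theorem addcancel (c c' : X → X → ZMod 2) : c + (c + c') = c' := by
  funext a b; simp only [Pi.add_apply]; grind

theorem addcancel' (c c' : X → X → ZMod 2) : (c + c') + c' = c := by
  funext a b; simp only [Pi.add_apply]; grind

theorem EX.add (h : EX c q) (h' : EX c' q) : EX (c + c') q := by
  obtain ⟨u, h⟩ := h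
  obtain ⟨u', h'⟩ := h'
  refine ⟨u + u', ?_⟩
  filter_upwards [h, h'] with y a b using a.add b

theorem LC.ex (h : LC c q) : EX c q := by
  obtain ⟨u, h⟩ := h
  exact ⟨u, h.eventually.filter_mono nhdsWithin_le_nhds⟩

theorem EX.comp {f : Y → X} {y : Y} (hf : ContinuousAt f y) (hfi : ∀ᶠ z in 𝓝[≠] y, ContinuousAt f z ∧ f z ≠ f y)
    (h : EX c (f y)) : EX (fun a b => c (f a) (f b)) y := by
  obtain ⟨u, h⟩ := h
  refine ⟨u ∘ f, ?_⟩
  rw [eventually_nhdsWithin_iff] at h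
  have h2 : ∀ᶠ z in 𝓝[≠] y, f z ∈ ({f y}ᶜ : Set X) → Pr c u (f z) :=
    (hf.eventually h).filter_mono nhdsWithin_le_nhds
  filter_upwards [h2, hfi] with z hz hz2
  exact (hz hz2.2).comp hz2.1

end basics

section emb
variable {X Y : Type*} [TopologicalSpace X] [TopologicalSpace Y] [Nonempty Y]
variable {φ : Y → X}

theorem inv_apply (hφ : IsOpenEmbedding φ) (p : Y) : Function.invFun φ (φ p) = p :=
  Function.leftInverse_invFun hφ.injective p

theorem inv_cont (hφ : IsOpenEmbedding φ) (p : Y) : ContinuousAt (Function.invFun φ) (φ p) := by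
  unfold ContinuousAt
  rw [← hφ.map_nhds_eq, inv_apply hφ, tendsto_map'_iff]
  have : Function.invFun φ ∘ φ = id := funext fun p => inv_apply hφ p
  rw [this]; exact tendsto_id

theorem pr_push (hφ : IsOpenEmbedding φ) {c : X → X → ZMod 2} {u : Y → ZMod 2} {p : Y}
    (h : Pr (fun a b => c (φ a) (φ b)) u p) : Pr c (u ∘ Function.invFun φ) (φ p) := by
  have h1 : Pr (fun a b => c (φ a) (φ b)) u (Function.invFun φ (φ p)) := by rwa [inv_apply hφ]
  have h2 := h1.comp (inv_cont hφ p)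
  refine h2.congrc (hφ.isOpen_range.mem_nhds ⟨p, rfl⟩) ?_
  rintro _ ⟨a, rfl⟩ _ ⟨b, rfl⟩
  simp [inv_apply hφ]

theorem lc_push (hφ : IsOpenEmbedding φ) {c : X → X → ZMod 2} {p : Y}
    (h : LC (fun a b => c (φ a) (φ b)) p) : LC c (φ p) := by
  obtain ⟨u, h⟩ := h
  exact ⟨_, pr_push hφ h⟩

theorem ex_push (hφ : IsOpenEmbedding φ) {c : X → X → ZMod 2} {p : Y}
    (h : EX (fun a b => c (φ a) (φ b)) p) : EX c (φ p) := by
  obtain ⟨u, h⟩ := h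
  refine ⟨u ∘ Function.invFun φ, ?_⟩
  rw [eventually_nhdsWithin_iff] at h ⊢
  rw [← hφ.map_nhds_eq, eventually_map]
  filter_upwards [h] with y hy hy2
  exact pr_push hφ (hy (fun h => hy2 (by simp at h; simp [h])))

theorem ex_pull (hφ : IsOpenEmbedding φ) {c : X → X → ZMod 2} {p : Y}
    (h : EX c (φ p)) : EX (fun a b => c (φ a) (φ b)) p := by
  refine h.comp hφ.continuous.continuousAt ?_
  filter_upwards [self_mem_nhdsWithin] with z hz
  exact ⟨hφ.continuous.continuousAt, fun h => hz (hφ.injective h)⟩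

end emb

open Classical in
/-- extension by zero -/
noncomputable def push {X Y : Type*} (φ : Y → X) (c : Y → Y → ZMod 2) : X → X → ZMod 2 :=
  fun a b => if ∃ p q, φ p = a ∧ φ q = b ∧ c p q ≠ 0 then 1 else 0

section push
variable {X Y : Type*} [TopologicalSpace X] [TopologicalSpace Y]
variable {φ : Y → X}

theorem push_apply (hφ : IsOpenEmbedding φ) (c : Y → Y → ZMod 2) (p q : Y) : push φ c (φ p) (φ q) = c p q := by
  unfold push
  by_cases h : c p q = 0
  · rw [h, if_neg]
    rintro ⟨p', q', h1, h2, h3⟩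
    rw [hφ.injective h1, hφ.injective h2] at h3
    exact h3 h
  · rw [if_pos ⟨p, q, rfl, rfl, h⟩]
    generalize c p q = z at h
    revert z; decide

theorem push_comp (hφ : IsOpenEmbedding φ) (c : Y → Y → ZMod 2) : (fun a b => push φ c (φ a) (φ b)) = c := by
  funext a b; exact push_apply hφ c a b

theorem push_zero [T2Space X] (hc : Continuous φ) {c : Y → Y → ZMod 2} {K : Set Y} (hK : IsCompact K)
    (h : ∀ a b, c a b ≠ 0 → a ∈ K ∧ b ∈ K) {x : X} (hx : x ∉ φ '' K) : Pr (push φ c) 0 x := by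
  refine ⟨(φ '' K)ᶜ, (hK.image hc).isClosed.isOpen_compl.mem_nhds hx, fun a ha b hb => ?_⟩
  unfold push
  rw [if_neg]; · simp
  rintro ⟨p, q, rfl, rfl, h3⟩
  exact ha ⟨p, (h p q h3).1, rfl⟩
end push

/-- Surfaces without boundary -/
def Surf (S : Type) [TopologicalSpace S] : Prop :=
  ∀ x : S, ∃ φ : ℝ × ℝ → S, IsOpenEmbedding φ ∧ φ 0 = x

/-- fix at a puncture -/
theorem fix {X : Type*} [TopologicalSpace X] [T2Space X] [RegularSpace X] {c : X → X → ZMod 2} {q : X} (h : EX c q)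
    {U : Set X} (hU : U ∈ 𝓝 q) : ∃ c' : X → X → ZMod 2, LC c' q ∧ (∀ y ∉ U, Leq c' c y) ∧
      ∃ v, ∀ y, y ≠ q → Pr (c + c') v y := by
  classical
  obtain ⟨u, h⟩ := h
  rw [eventually_nhdsWithin_iff] at h
  obtain ⟨N', hN', hcl, hsub⟩ := exists_mem_nhds_isClosed_subset (inter_mem h hU)
  let v : X → ZMod 2 := fun a => if a ∈ N' then u a else 0
  refine ⟨fun a b => if a ∈ N' ∧ b ∈ N' then 0 else c a b + v a + v b, ?_, ?_, v, ?_⟩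
  · refine ⟨0, N', hN', fun a ha b hb => by simp [ha, hb]⟩
  · intro y hy
    refine ⟨N'ᶜ, hcl.isOpen_compl.mem_nhds fun h => hy (hsub h).2, fun a ha b hb => ?_⟩
    have ha' : a ∉ N' := ha
    have hb' : b ∉ N' := hb
    simp [ha', hb', v]
  · intro y hy
    by_cases hyN : y ∈ N'
    · obtain ⟨N0, hN0, h0⟩ := (hsub hyN).1 hy
      refine ⟨N0, hN0, fun a ha b hb => ?_⟩
      simp only [Pi.add_apply]
      have := h0 a ha b hb
      by_cases hab : a ∈ N' ∧ b ∈ N'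
      · simp [hab, v, this]
      · rw [if_neg hab]; grind
    · refine ⟨N'ᶜ, hcl.isOpen_compl.mem_nhds hyN, fun a ha b hb => ?_⟩
      have ha' : a ∉ N' := ha
      have hb' : b ∉ N' := hb
      simp only [Pi.add_apply, ha', hb', v]
      simp; grind

theorem codim {S : Type} [TopologicalSpace S] (hS : Surf S) (c c' : S → S → ZMod 2) (q : S)
    (h : ∀ᶠ y in 𝓝[≠] q, LC c y) (h' : ∀ᶠ y in 𝓝[≠] q, LC c' y) :
    EX c q ∨ EX c' q ∨ EX (c + c') q := by
  obtain ⟨φ, hφ, rfl⟩ := hS q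
  rw [eventually_nhdsWithin_iff] at h h'
  have hh := hφ.continuous.continuousAt.eventually (h.and h')
  obtain ⟨r, hr, hb⟩ := Metric.eventually_nhds_iff_ball.1 hh
  have key := plane_codim (convex_ball (0:ℝ × ℝ) r) Metric.isOpen_ball
    (fun a b => c (φ a) (φ b)) (fun a b => c' (φ a) (φ b))
    (fun y hy hy0 => ((hb y hy).1 (fun hh => hy0 (hφ.injective hh))).comp hφ.continuous.continuousAt)
    (fun y hy hy0 => ((hb y hy).2 (fun hh => hy0 (hφ.injective hh))).comp hφ.continuous.continuousAt)
  have aux : ∀ d : S → S → ZMod 2, (∃ u, ∀ y ∈ Metric.ball (0:ℝ×ℝ) r, y ≠ 0 → Pr (fun a b => d (φ a) (φ b)) u y) →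
      EX d (φ 0) := by
    rintro d ⟨u, hu⟩
    refine ex_push hφ ⟨u, ?_⟩
    rw [eventually_nhdsWithin_iff]
    filter_upwards [Metric.ball_mem_nhds 0 hr] with y hy hy0
    exact hu y hy hy0
  rcases key with k | k | k
  · exact Or.inl (aux _ k)
  · exact Or.inr (Or.inl (aux _ k))
  · exact Or.inr (Or.inr (aux _ k))
end EG
end
section
open Set Filter Topology
namespace EG

open Classical in
/-- sign of second coordinate -/
noncomputable def sgn (a : ℝ × ℝ) : ZMod 2 := if 0 ≤ a.2 then 1 else 0

def KK : Set (ℝ × ℝ) := Icc 0 1 ×ˢ Icc (-1) 1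

open Classical in
/-- The class of the unit segment. -/
noncomputable def seg : ℝ × ℝ → ℝ × ℝ → ZMod 2 :=
  fun a b => if a ∈ KK ∧ b ∈ KK then sgn a + sgn b else 0

theorem seg_zero {y : ℝ × ℝ} (hy : ¬ (y.2 = 0 ∧ 0 ≤ y.1 ∧ y.1 ≤ 1)) : Pr seg 0 y := by
  by_cases hk : y.2 = 0
  · have hopen : IsOpen {a : ℝ × ℝ | a.1 < 0 ∨ 1 < a.1} :=
      (isOpen_lt continuous_fst continuous_const).union (isOpen_lt continuous_const continuous_fst)
    refine ⟨_, hopen.mem_nhds (x := y) ?_, fun a ha b hb => ?_⟩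
    · simp only [mem_ofPred_eq]; by_contra hc; push Not at hc; exact hy ⟨hk, hc⟩
    · unfold seg
      rw [if_neg]; · simp
      rintro ⟨h1, -⟩
      simp only [KK, mem_prod, mem_Icc] at h1
      rcases ha with h | h <;> linarith [h1.1.1, h1.1.2]
  · rcases lt_or_gt_of_ne hk with h | h
    · refine ⟨{a | a.2 < 0}, (isOpen_lt continuous_snd continuous_const).mem_nhds h, fun a ha b hb => ?_⟩
      have ha : a.2 < 0 := ha
      have hb : b.2 < 0 := hb
      unfold seg sgn; simp [not_le.2 ha, not_le.2 hb]
    · refine ⟨{a | 0 < a.2}, (isOpen_lt continuous_const continuous_snd).mem_nhds h, fun a ha b hb => ?_⟩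
      have ha : 0 < a.2 := ha
      have hb : 0 < b.2 := hb
      unfold seg sgn; simp [ha.le, hb.le]; intros; grind

theorem seg_sgn {y : ℝ × ℝ} (hy : y.2 = 0 ∧ 0 < y.1 ∧ y.1 < 1) : Pr seg sgn y := by
  have hopen : IsOpen (Ioo (0:ℝ) 1 ×ˢ Ioo (-1:ℝ) 1) := isOpen_Ioo.prod isOpen_Ioo
  refine ⟨_, hopen.mem_nhds (x := y) ?_, fun a ha b hb => ?_⟩
  · simp [hy.1, hy.2]
  · unfold seg
    rw [if_pos]
    exact ⟨⟨⟨ha.1.1.le, ha.1.2.le⟩, ⟨ha.2.1.le, ha.2.2.le⟩⟩, ⟨⟨hb.1.1.le, hb.1.2.le⟩, ⟨hb.2.1.le, hb.2.2.le⟩⟩⟩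

theorem seg_lc {y : ℝ × ℝ} (h0 : y ≠ (0, 0)) (h1 : y ≠ (1, 0)) : LC seg y := by
  by_cases hy : y.2 = 0 ∧ 0 ≤ y.1 ∧ y.1 ≤ 1
  · refine ⟨_, seg_sgn ⟨hy.1, lt_of_le_of_ne hy.2.1 fun h => h0 ?_, lt_of_le_of_ne hy.2.2 fun h => h1 ?_⟩⟩
    · ext <;> simp [h.symm, hy.1]
    · ext <;> simp [h, hy.1]
  · exact ⟨_, seg_zero hy⟩

theorem seg_supp (a b : ℝ × ℝ) (h : seg a b ≠ 0) : a ∈ KK ∧ b ∈ KK := by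
  unfold seg at h
  by_contra hc
  rw [if_neg hc] at h
  exact h rfl

theorem seg_not_ex0 : ¬ EX seg (0, 0) := by
  rintro ⟨u, h⟩
  rw [eventually_nhdsWithin_iff] at h
  obtain ⟨r, hr, hb⟩ := Metric.eventually_nhds_iff_ball.1 h
  set B := Metric.ball ((0:ℝ), (0:ℝ)) r with hB
  have hBc : Convex ℝ B := convex_ball _ _
  have hmem : ∀ a : ℝ × ℝ, a ∈ B ↔ |a.1| < r ∧ |a.2| < r := by
    intro a; simp [hB, Metric.mem_ball, Prod.dist_eq]
  have half : ∀ W : Set (ℝ × ℝ), Convex ℝ W → (∀ y ∈ W, ¬ (y.2 = 0 ∧ 0 ≤ y.1 ∧ y.1 ≤ 1)) →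
      ∃ k, ∀ a ∈ B ∩ W, u a = k := by
    intro W hW hy
    obtain ⟨k, hk⟩ := Pr.const' (W := B ∩ W) (c := seg) (u := 0) (u' := u) (hBc.inter hW).isPreconnected
      (fun y hy' => seg_zero (hy y hy'.2)) (fun y hy' => hb y hy'.1 (by
        rintro rfl; exact hy _ hy'.2 (by simp)))
    exact ⟨k, fun a ha => by simpa using hk a ha⟩
  obtain ⟨k1, hk1⟩ := half {a | 0 < a.2} (convex_halfSpace_gt (f := Prod.snd) ⟨fun _ _ => rfl, fun _ _ => rfl⟩ 0)
    (by intro y hy h; have : 0 < y.2 := hy; linarith [h.1])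
  obtain ⟨k2, hk2⟩ := half {a | a.1 < 0} (convex_halfSpace_lt (f := Prod.fst) ⟨fun _ _ => rfl, fun _ _ => rfl⟩ 0)
    (by intro y hy h; have : y.1 < 0 := hy; linarith [h.2.1])
  obtain ⟨k3, hk3⟩ := half {a | a.2 < 0} (convex_halfSpace_lt (f := Prod.snd) ⟨fun _ _ => rfl, fun _ _ => rfl⟩ 0)
    (by intro y hy h; have : y.2 < 0 := hy; linarith [h.1])
  have hr2 : |r / 2| < r := by rw [abs_of_pos (by linarith)]; linarith
  have hr2' : |-(r / 2)| < r := by rw [abs_neg]; exact hr2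
  have e12 : k1 = k2 := by
    rw [← hk1 (-(r/2), r/2) ⟨(hmem _).2 ⟨hr2', hr2⟩, by simp [hr]⟩,
      hk2 (-(r/2), r/2) ⟨(hmem _).2 ⟨hr2', hr2⟩, by simp [hr]⟩]
  have e23 : k2 = k3 := by
    rw [← hk2 (-(r/2), -(r/2)) ⟨(hmem _).2 ⟨hr2', hr2'⟩, by simp [hr]⟩,
      hk3 (-(r/2), -(r/2)) ⟨(hmem _).2 ⟨hr2', hr2'⟩, by simp [hr]⟩]
  set s := min (r / 2) (1 / 2) with hs
  have hs0 : 0 < s := by positivity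
  have hs1 : s ≤ r / 2 := min_le_left _ _
  have hs2 : s ≤ 1 / 2 := min_le_right _ _
  have hP1 : Pr seg u (s, 0) := hb _ ((hmem _).2 ⟨by rw [abs_of_pos hs0]; linarith, by simpa using hr⟩)
    (by simp; intro h; linarith)
  have hP2 : Pr seg sgn (s, 0) := seg_sgn ⟨rfl, hs0, by simp; linarith⟩
  have hev := hP1.unique hP2
  have hcont : Tendsto (fun t : ℝ => ((s, t) : ℝ × ℝ)) (𝓝 0) (𝓝 (s, 0)) :=
    (Continuous.tendsto (by fun_prop) 0)
  obtain ⟨ε, hε, hball⟩ := Metric.eventually_nhds_iff.1 (hcont.eventually hev)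
  set t := min (ε / 2) (r / 2) with ht
  have ht0 : 0 < t := by positivity
  have ht1 : t ≤ ε / 2 := min_le_left _ _
  have ht2 : t ≤ r / 2 := min_le_right _ _
  have E1 := hball (y := t) (by simp [abs_of_pos ht0]; linarith)
  have E2 := hball (y := -t) (by simp [abs_of_pos ht0]; linarith)
  rw [hk1 (s, t) ⟨(hmem _).2 ⟨by rw [abs_of_pos hs0]; linarith, by simp [abs_of_pos ht0]; linarith⟩, ht0⟩] at E1
  rw [hk3 (s, -t) ⟨(hmem _).2 ⟨by rw [abs_of_pos hs0]; linarith, by simp [abs_of_pos ht0]; linarith⟩,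
    by simp [ht0]⟩] at E2
  simp only [sgn, ht0.le, if_true, show ¬ (0 ≤ -t) by linarith, if_false] at E1 E2
  rw [← E2, e12, e23] at E1
  simp at E1

theorem seg_not_ex1 : ¬ EX seg (1, 0) := by
  intro h
  apply seg_not_ex0
  let f : ℝ × ℝ → ℝ × ℝ := fun a => (1 - a.1, a.2)
  have hf : Continuous f := by fun_prop
  have h' : EX seg (f (0, 0)) := by simpa [f] using h
  have h2 := h'.comp hf.continuousAt (by
    filter_upwards [self_mem_nhdsWithin] with z hz
    refine ⟨hf.continuousAt, fun h => hz ?_⟩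
    simp only [f, Prod.mk.injEq] at h
    ext <;> simp <;> linarith [h.1, h.2])
  convert h2 using 1
  funext a b
  have hK : ∀ a, f a ∈ KK ↔ a ∈ KK := by
    intro a; simp only [f, KK, mem_prod, mem_Icc]
    constructor <;> rintro ⟨⟨h1, h2⟩, h3⟩ <;> exact ⟨⟨by linarith, by linarith⟩, h3⟩
  unfold seg
  by_cases hab : a ∈ KK ∧ b ∈ KK
  · rw [if_pos hab, if_pos (by rw [hK, hK]; exact hab)]; rfl
  · rw [if_neg hab, if_neg (by rw [hK, hK]; exact hab)]

/-- `m` is a class with nontrivial local monodromy exactly at `q` and `q'`. -/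
def MoveRel {X : Type*} [TopologicalSpace X] (U : Set X) (q q' : X) : Prop :=
  q = q' ∨ ∃ m : X → X → ZMod 2, (∀ y, y ≠ q → y ≠ q' → LC m y) ∧ ¬ EX m q ∧ ¬ EX m q' ∧
    ∀ y ∉ U, Pr m 0 y

theorem move_local {S : Type} [TopologicalSpace S] [T2Space S] (hS : Surf S) {U : Set S} (hU : IsOpen U)
    {q : S} (hq : q ∈ U) : ∀ᶠ q' in 𝓝 q, MoveRel U q q' := by
  obtain ⟨φ, hφ, rfl⟩ := hS q
  have hpre : φ ⁻¹' U ∈ 𝓝 (0 : ℝ × ℝ) := hφ.continuous.continuousAt (hU.mem_nhds hq)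
  obtain ⟨r, hr, hb⟩ := Metric.mem_nhds_iff.1 hpre
  rw [← hφ.map_nhds_eq, eventually_map]
  filter_upwards [Metric.ball_mem_nhds (0 : ℝ × ℝ) (show 0 < r / 3 by linarith)] with w hw
  by_cases hw0 : w = 0
  · left; rw [hw0]
  right
  obtain ⟨x, y⟩ := w
  have hxy : x ^ 2 + y ^ 2 ≠ 0 := by
    intro h
    apply hw0
    have hx : x = 0 := by nlinarith [sq_nonneg x, sq_nonneg y]
    have hy : y = 0 := by nlinarith [sq_nonneg x, sq_nonneg y]
    simp [hx, hy]
  let A : (ℝ × ℝ) ≃ₜ (ℝ × ℝ) :=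
    { toFun := fun a => (x * a.1 - y * a.2, y * a.1 + x * a.2)
      invFun := fun a => ((x * a.1 + y * a.2) / (x ^ 2 + y ^ 2), (x * a.2 - y * a.1) / (x ^ 2 + y ^ 2))
      left_inv := by intro a; ext <;> simp <;> field_simp <;> ring
      right_inv := by intro a; ext <;> simp <;> field_simp <;> ring
      continuous_toFun := by fun_prop
      continuous_invFun := by fun_prop }
  have hψ : IsOpenEmbedding (φ ∘ A) := hφ.comp A.isOpenEmbedding
  have hA0 : A (0, 0) = 0 := by ext <;> simp [A]
  have hA1 : A (1, 0) = (x, y) := by ext <;> simp [A]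
  have e0 : (φ ∘ A) (0, 0) = φ 0 := by simp [hA0]
  have e1 : (φ ∘ A) (1, 0) = φ (x, y) := by simp [hA1]
  have hKc : IsCompact KK := isCompact_Icc.prod isCompact_Icc
  have hz : ∀ z ∉ (φ ∘ A) '' KK, Pr (push (φ ∘ A) seg) 0 z := fun z hz =>
    push_zero hψ.continuous hKc seg_supp hz
  refine ⟨push (φ ∘ A) seg, ?_, ?_, ?_, ?_⟩
  · intro z hz0 hz1
    by_cases hzK : z ∈ (φ ∘ A) '' KK
    · obtain ⟨p, hp, rfl⟩ := hzK
      apply lc_push hψ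
      rw [push_comp hψ]
      refine seg_lc ?_ ?_
      · rintro rfl; exact hz0 e0
      · rintro rfl; exact hz1 e1
    · exact ⟨_, hz z hzK⟩
  · rw [← e0]
    intro h
    have := ex_pull hψ h
    rw [push_comp hψ] at this
    exact seg_not_ex0 this
  · rw [← e1]
    intro h
    have := ex_pull hψ h
    rw [push_comp hψ] at this
    exact seg_not_ex1 this
  · intro z hzU
    apply hz
    rintro ⟨p, hp, rfl⟩
    apply hzU
    apply hb
    simp only [Metric.mem_ball, Prod.dist_eq, Real.dist_eq] at hw ⊢
    simp only [Prod.fst_zero, Prod.snd_zero, sub_zero, max_lt_iff] at hw ⊢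
    simp only [KK, mem_prod, mem_Icc] at hp
    have h1 : |p.1| ≤ 1 := abs_le.2 ⟨by linarith [hp.1.1], hp.1.2⟩
    have h2 : |p.2| ≤ 1 := abs_le.2 hp.2
    have m : ∀ s t : ℝ, |t| ≤ 1 → |s| < r / 3 → |s * t| < r / 3 := fun s t h h' => by
      rw [abs_mul]; nlinarith [abs_nonneg s, abs_nonneg t]
    have a1 := abs_lt.1 (m x _ h1 hw.1)
    have a2 := abs_lt.1 (m y _ h2 hw.2)
    have a3 := abs_lt.1 (m y _ h1 hw.2)
    have a4 := abs_lt.1 (m x _ h2 hw.1)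
    have b1 : (A p).1 = x * p.1 - y * p.2 := rfl
    have b2 : (A p).2 = y * p.1 + x * p.2 := rfl
    rw [b1, b2]
    refine ⟨?_, ?_⟩ <;> rw [abs_lt] <;> constructor <;> linarith

theorem eventually_ne_lc {S : Type} [TopologicalSpace S] [T1Space S] {m : S → S → ZMod 2} {q q' : S}
    (h : ∀ y, y ≠ q → y ≠ q' → LC m y) (p : S) : ∀ᶠ y in 𝓝[≠] p, LC m y := by
  have aux : ∀ r : S, ∀ᶠ y in 𝓝[≠] p, y ≠ r := by
    intro r
    by_cases hr : r = p
    · subst hr; exact self_mem_nhdsWithin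
    · exact (isOpen_compl_singleton.mem_nhds (Ne.symm hr : p ∈ ({r}ᶜ : Set S))) |> fun h => mem_nhdsWithin_of_mem_nhds h
  filter_upwards [aux q, aux q'] with y h1 h2 using h y h1 h2

theorem move {S : Type} [TopologicalSpace S] [T2Space S] [RegularSpace S] (hS : Surf S) {U : Set S} (hU : IsOpen U)
    (hUc : IsPreconnected U) {q q' : S} (hq : q ∈ U) (hq' : q' ∈ U) : MoveRel U q q' := by
  refine hUc.induction₂ (MoveRel U) ?_ ?_ ?_ hq hq'
  · intro x hx
    exact (move_local hS hU hx).filter_mono nhdsWithin_le_nhds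
  · intro x y z hx hy hz h1 h2
    by_cases hxz : x = z
    · exact Or.inl hxz
    rcases h1 with rfl | ⟨m, hm, hmx, hmy, hm0⟩
    · exact h2
    rcases h2 with rfl | ⟨m', hm', hmy', hmz', hm0'⟩
    · exact Or.inr ⟨m, hm, hmx, hmy, hm0⟩
    by_cases hxy : x = y
    · subst hxy; exact Or.inr ⟨m', hm', hmy', hmz', hm0'⟩
    by_cases hyz : y = z
    · subst hyz; exact Or.inr ⟨m, hm, hmx, hmy, hm0⟩
    have hex : EX (m + m') y := by
      rcases codim hS m m' y (eventually_ne_lc hm y) (eventually_ne_lc hm' y) with h | h | h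
      · exact absurd h hmy
      · exact absurd h hmy'
      · exact h
    obtain ⟨c, hcy, hcU, v, hcv⟩ := fix hex (hU.mem_nhds hy)
    refine Or.inr ⟨c, ?_, ?_, ?_, ?_⟩
    · intro p hpx hpz
      by_cases hpy : p = y
      · rw [hpy]; exact hcy
      · have h1 : LC (m + m') p := (hm p hpx hpy).add (hm' p hpy hpz)
        have h2 := h1.add (hcv p hpy).lc
        rwa [addcancel] at h2
    · intro hc
      apply hmx
      have h1 : EX (m + m') x := by
        have := EX.add (hcv x hxy).lc.ex hc
        rwa [addcancel'] at this
      have := h1.add (hm' x hxy hxz).ex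
      rwa [addcancel'] at this
    · intro hc
      apply hmz'
      have h1 : EX (m + m') z := by
        have := EX.add (hcv z (Ne.symm hyz)).lc.ex hc
        rwa [addcancel'] at this
      have := (hm z (Ne.symm hxz) (Ne.symm hyz)).ex.add h1
      rwa [addcancel] at this
    · intro p hp
      refine (hcU p hp).pr ?_
      have := (hm0 p hp).add (hm0' p hp)
      simpa using this
  · intro x y hx hy h
    rcases h with rfl | ⟨m, hm, hmx, hmy, hm0⟩
    · exact Or.inl rfl
    · exact Or.inr ⟨m, fun p h1 h2 => hm p h2 h1, hmy, hmx, hm0⟩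

/-- move one puncture -/
theorem move_one {S : Type} [TopologicalSpace S] [T2Space S] [RegularSpace S] (hS : Surf S) {U : Set S} (hU : IsOpen U)
    (hUc : IsPreconnected U) {q p : S} (hq : q ∈ U) (hp : p ∈ U) (hqp : q ≠ p) {c : S → S → ZMod 2}
    (hc : ∀ᶠ y in 𝓝[≠] q, LC c y) : ∃ c', LC c' q ∧ (∀ y ∉ U, Leq c' c y) ∧
      ∀ y, y ≠ q → y ≠ p → LC c y → LC c' y := by
  have key : ∃ d, EX d q ∧ (∀ y ∉ U, Leq d c y) ∧ ∀ y, y ≠ q → y ≠ p → LC c y → LC d y := by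
    rcases move hS hU hUc hq hp with h | ⟨m, hm, hmq, hmp, hm0⟩
    · exact absurd h hqp
    rcases codim hS c m q hc (eventually_ne_lc hm q) with h | h | h
    · exact ⟨c, h, fun y _ => Leq.refl c y, fun y _ _ h => h⟩
    · exact absurd h hmq
    · exact ⟨c + m, h, fun y hy => Leq.add_zero (hm0 y hy), fun y h1 h2 h3 => h3.add (hm y h1 h2)⟩
  obtain ⟨d, hd, hdU, hdl⟩ := key
  obtain ⟨c', h1, h2, v, h3⟩ := fix hd (hU.mem_nhds hq)
  refine ⟨c', h1, fun y hy => (h2 y hy).trans (hdU y hy), fun y hyq hyp hy => ?_⟩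
  have := (hdl y hyq hyp hy).add (h3 y hyq).lc
  rwa [addcancel] at this

end EG
end
section
open Set Filter Topology
namespace EG

theorem punctured_ball (r : ℝ) (hr : 0 < r) : IsPreconnected (Metric.ball (0 : ℝ × ℝ) r \ {0}) := by
  have h1 : IsPreconnected ({0}ᶜ : Set (ℝ × ℝ)) :=
    (isConnected_compl_singleton_of_one_lt_rank (by simp [one_add_one_eq_two]) 0).isPreconnected
  let f : ℝ × ℝ → ℝ × ℝ := fun y => (r / (1 + ‖y‖)) • y
  have hf : Continuous f := by
    have h3 : Continuous (fun y : ℝ × ℝ => r / (1 + ‖y‖)) :=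
      continuous_const.div (by fun_prop) (fun y => by positivity)
    exact h3.smul (g := fun y => y) continuous_id
  have h2 := h1.image f hf.continuousOn
  convert h2 using 1
  ext z
  simp only [Set.mem_sdiff, Metric.mem_ball, dist_zero_right, mem_singleton_iff, mem_image, mem_compl_iff]
  constructor
  · rintro ⟨hz, hz0⟩
    have hp : 0 < r - ‖z‖ := by linarith
    refine ⟨(r - ‖z‖)⁻¹ • z, ?_, ?_⟩
    · simp [hz0, hp.ne']
    · simp only [f, norm_smul, norm_inv, Real.norm_eq_abs, abs_of_pos hp, smul_smul]
      have : r / (1 + (r - ‖z‖)⁻¹ * ‖z‖) * (r - ‖z‖)⁻¹ = 1 := by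
        have e : 1 + (r - ‖z‖)⁻¹ * ‖z‖ = r / (r - ‖z‖) := by field_simp; ring
        rw [e]; field_simp
      rw [this, one_smul]
  · rintro ⟨y, hy, rfl⟩
    have hn : 0 < ‖y‖ := norm_pos_iff.2 hy
    refine ⟨?_, ?_⟩
    · simp only [f, norm_smul, Real.norm_eq_abs]
      rw [abs_of_pos (by positivity), div_mul_eq_mul_div, div_lt_iff₀ (by positivity)]
      nlinarith
    · simp only [f, smul_eq_zero, hy, or_false]
      positivity

theorem fill_one {S : Type} [TopologicalSpace S] [T1Space S] (hS : Surf S) {c : S → S → ZMod 2} {u : S → ZMod 2}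
    {W : Set S} {p : S} (hW : IsOpen W) (hp : p ∈ W) (hc : LC c p) (h : ∀ y ∈ W, y ≠ p → Pr c u y) :
    ∃ u', (∀ y ∈ W, Pr c u' y) ∧ ∀ y, y ≠ p → u' y = u y := by
  classical
  obtain ⟨w, hw⟩ := hc
  obtain ⟨φ, hφ, rfl⟩ := hS p
  have hev := hφ.continuous.continuousAt.eventually (hw.eventually.and (hW.mem_nhds hp))
  obtain ⟨r, hr, hb⟩ := Metric.eventually_nhds_iff_ball.1 hev
  have hpre := (punctured_ball r hr).image φ hφ.continuous.continuousOn
  obtain ⟨k, hk⟩ := Pr.const' hpre (c := c) (u := w) (u' := u)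
    (by rintro _ ⟨y, hy, rfl⟩; exact (hb y hy.1).1)
    (by rintro _ ⟨y, hy, rfl⟩; exact h _ (hb y hy.1).2 (fun e => hy.2 (hφ.injective e)))
  refine ⟨Function.update u (φ 0) (w (φ 0) + k), ?_, fun y hy => Function.update_of_ne hy _ _⟩
  intro y hy
  by_cases hyp : y = φ 0
  · subst hyp
    refine hw.congr (k := k) ?_
    rw [← hφ.map_nhds_eq, eventually_map]
    filter_upwards [Metric.ball_mem_nhds 0 hr] with z hz
    by_cases hz0 : z = 0
    · subst hz0; simp
    · rw [Function.update_of_ne (fun e => hz0 (hφ.injective e))]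
      exact hk _ ⟨z, ⟨hz, hz0⟩, rfl⟩
  · refine (h y hy hyp).congr0 ?_
    filter_upwards [isOpen_compl_singleton.mem_nhds (show y ∈ ({φ 0}ᶜ : Set S) from hyp)] with a ha
    exact Function.update_of_ne ha _ _

theorem fill {S : Type} [TopologicalSpace S] [T1Space S] (hS : Surf S) {c : S → S → ZMod 2}
    {P : Set S} (hP : P.Finite) : ∀ {u : S → ZMod 2}, (∀ p ∈ P, LC c p) → (∀ y, y ∉ P → Pr c u y) →
    ∃ u', (∀ y, Pr c u' y) ∧ ∀ y, y ∉ P → u' y = u y := by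
  induction P, hP using Set.Finite.induction_on with
  | empty => intro u _ h; exact ⟨u, fun y => h y (by simp), fun y _ => rfl⟩
  | @insert p P hp hP ih =>
    intro u h1 h2
    obtain ⟨u1, h3, h4⟩ := fill_one hS (W := Pᶜ) (p := p) (u := u) (c := c) hP.isClosed.isOpen_compl hp
      (h1 p (by simp)) (fun y hy hyp => h2 y (by simp [hyp]; exact hy))
    obtain ⟨u2, h5, h6⟩ := ih (u := u1) (fun q hq => h1 q (by simp [hq])) h3
    refine ⟨u2, h5, fun y hy => ?_⟩
    simp only [mem_insert_iff, not_or] at hy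
    rw [h6 y hy.2, h4 y hy.1]

/-- moving a finite set of punctures -/
theorem move_all {S : Type} [TopologicalSpace S] [T2Space S] [RegularSpace S] (hS : Surf S) (G P : Set S)
    (hP : P.Finite) {Q : Set S} (hQ : Q.Finite) : ∀ (c : S → S → ZMod 2),
    (∀ q ∈ Q, ∃ p ∈ P, ∃ U, IsOpen U ∧ IsPreconnected U ∧ q ∈ U ∧ p ∈ U ∧ U ⊆ Gᶜ) →
    (∀ y, y ∉ Q → y ∉ P → LC c y) → ∃ c', (∀ y, y ∉ P → LC c' y) ∧ ∀ y ∈ G, Leq c' c y := by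
  induction Q, hQ using Set.Finite.induction_on with
  | empty => intro c _ h; exact ⟨c, fun y => h y (by simp), fun y _ => Leq.refl c y⟩
  | @insert q Q hq hQ ih =>
    intro c hm hc
    by_cases hqP : q ∈ P
    · exact ih c (fun q hq => hm q (by simp [hq])) (fun y h1 h2 => hc y (by
        rintro (rfl | h)
        · exact h2 hqP
        · exact h1 h) h2)
    · obtain ⟨p, hp, U, hU, hUc, hqU, hpU, hUG⟩ := hm q (by simp)
      have hev : ∀ᶠ y in 𝓝[≠] q, LC c y := by
        rw [eventually_nhdsWithin_iff]
        filter_upwards [hQ.isClosed.isOpen_compl.mem_nhds hq, hP.isClosed.isOpen_compl.mem_nhds hqP] with y h1 h2 h3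
        exact hc y (by rintro (h | h); exacts [h3 h, h1 h]) h2
      obtain ⟨c1, h1, h2, h3⟩ := move_one hS hU hUc hqU hpU (by rintro rfl; exact hqP hp) hev
      obtain ⟨c2, h4, h5⟩ := ih c1 (fun q hq => hm q (by simp [hq])) (fun y hyQ hyP => by
        by_cases hyq : y = q
        · rw [hyq]; exact h1
        · exact h3 y hyq (by rintro rfl; exact hyP hp)
            (hc y (by rintro (h | h); exacts [hyq h, hyQ h]) hyP))
      exact ⟨c2, h4, fun y hy => (h5 y hy).trans (h2 y (fun h => hUG h hy))⟩

theorem taut {S : Type} [TopologicalSpace S] [TopologicalSpace.MetrizableSpace S] {G : Set S} (hG : IsCompact G)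
    (hne : G.Nonempty) {c : S → S → ZMod 2} {u : S → ZMod 2} (hc : ∀ x ∈ G, LC c x)
    (hu : ∀ x ∈ G, ∀ᶠ a in 𝓝[G] x, c a x = u a + u x) :
    ∃ u', (∀ x ∈ G, Pr c u' x) ∧ (∀ x ∈ G, u' x = u x) ∧
      ∀ y ∈ G, (∀ᶠ a in 𝓝[G] y, u a = 0) → Pr c 0 y → ∀ᶠ a in 𝓝 y, u' a = 0 := by
  classical
  letI := TopologicalSpace.metrizableSpaceMetric S
  have hr : ∀ a : S, ∃ y ∈ G, dist a y = Metric.infDist a G := fun a => by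
    obtain ⟨y, hy, h⟩ := hG.exists_infDist_eq_dist hne a
    exact ⟨y, hy, h.symm⟩
  choose r hrG hrd using hr
  have hr1 : ∀ x ∈ G, r x = x := by
    intro x hx
    have := hrd x
    rw [Metric.infDist_zero_of_mem hx] at this
    exact (dist_eq_zero.1 this).symm
  have hrc : ∀ x ∈ G, Tendsto r (𝓝 x) (𝓝[G] x) := by
    intro x hx
    rw [tendsto_nhdsWithin_iff]
    refine ⟨?_, Eventually.of_forall hrG⟩
    rw [Metric.tendsto_nhds]
    intro ε hε
    filter_upwards [Metric.ball_mem_nhds x (show 0 < ε / 2 by linarith)] with a ha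
    have h1 : dist a (r a) ≤ dist a x := by rw [hrd]; exact Metric.infDist_le_dist_of_mem hx
    have h2 : dist a x < ε / 2 := ha
    have h3 := dist_triangle (r a) a x
    rw [dist_comm (r a) a] at h3
    linarith
  refine ⟨fun a => u (r a) + c a (r a), ?_, ?_, ?_⟩
  · intro x hx
    obtain ⟨w, hw⟩ := hc x hx
    refine hw.congr (k := u x + w x) ?_
    obtain ⟨N, hN, h⟩ := hw
    have hrx := hrc x hx
    filter_upwards [hN, hrx.eventually (hu x hx), hrx.eventually (mem_nhdsWithin_of_mem_nhds hN)] with a h1 h2 h3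
    rw [h (r a) h3 x (mem_of_mem_nhds hN)] at h2
    rw [h a h1 (r a) h3]
    grind
  · intro x hx
    simp only [hr1 x hx, (hc x hx).diag, add_zero]
  · rintro y hy h1 ⟨N, hN, h⟩
    filter_upwards [hN, (hrc y hy).eventually h1, (hrc y hy).eventually (mem_nhdsWithin_of_mem_nhds hN)] with a h2 h3 h4
    rw [h3, h a h2 _ h4]; simp

section surf
variable {S : Type} [TopologicalSpace S]

theorem surf_of (h : ∀ x : S, ∃ U : Set S, IsOpen U ∧ x ∈ U ∧ Nonempty (↥U ≃ₜ (ℝ × ℝ))) : Surf S := by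
  intro x
  obtain ⟨U, hU, hx, ⟨e⟩⟩ := h x
  refine ⟨fun p => (e.symm (p + e ⟨x, hx⟩) : S), ?_, by simp⟩
  have h1 : IsOpenEmbedding (Subtype.val : U → S) := hU.isOpenEmbedding_subtypeVal
  exact h1.comp (e.symm.isOpenEmbedding.comp (Homeomorph.addRight (e ⟨x, hx⟩)).isOpenEmbedding)

theorem Surf.secondCountable (hS : Surf S) [CompactSpace S] : SecondCountableTopology S := by
  choose φ hφ h0 using hS
  obtain ⟨t, ht⟩ := isCompact_univ.elim_finite_subcover (fun x => range (φ x)) (fun x => (hφ x).isOpen_range)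
    (fun x _ => mem_iUnion.2 ⟨x, 0, h0 x⟩)
  haveI : ∀ i : t, SecondCountableTopology (range (φ i)) := fun i =>
    (hφ i).toIsEmbedding.toHomeomorph.symm.secondCountableTopology
  refine TopologicalSpace.secondCountableTopology_of_countable_cover (ι := t) (U := fun i => range (φ i))
    (fun i => (hφ i).isOpen_range) ?_
  rw [eq_univ_iff_forall]
  intro x
  have := ht (mem_univ x)
  simp only [mem_iUnion] at this ⊢
  obtain ⟨i, hi, h⟩ := this
  exact ⟨⟨i, hi⟩, h⟩

theorem Surf.metrizable (hS : Surf S) [CompactSpace S] [T2Space S] : TopologicalSpace.MetrizableSpace S := by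
  haveI := hS.secondCountable
  infer_instance

theorem Surf.locConn (hS : Surf S) : LocallyConnectedSpace S := by
  rw [locallyConnectedSpace_iff_connected_subsets]
  intro x U hU
  obtain ⟨φ, hφ, rfl⟩ := hS x
  have := hφ.continuous.continuousAt hU
  obtain ⟨r, hr, hb⟩ := Metric.mem_nhds_iff.1 this
  refine ⟨φ '' Metric.ball 0 r, hφ.isOpenMap.image_mem_nhds (Metric.ball_mem_nhds 0 hr), ?_, image_subset_iff.2 hb⟩
  exact (convex_ball _ _).isPreconnected.image _ hφ.continuous.continuousOn
end surf
end EG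
end
section
open Set Filter Topology
namespace EG

open Classical in
/-- line integral from `0` to `t` along `g` -/
noncomputable def LI {S : Type} (c : S → S → ZMod 2) (g : ℝ → S) (t : ℝ) : ZMod 2 :=
  if h : ∃ u, ∀ t ∈ Icc (0:ℝ) 1, Pr (fun a b => c (g a) (g b)) u t then h.choose t + h.choose 0 else 0

section LI
variable {S : Type} [TopologicalSpace S] {c c' : S → S → ZMod 2} {g : ℝ → S}

theorem LI_eq {u : ℝ → ZMod 2} (hu : ∀ t ∈ Icc (0:ℝ) 1, Pr (fun a b => c (g a) (g b)) u t)
    {t : ℝ} (ht : t ∈ Icc (0:ℝ) 1) : LI c g t = u t + u 0 := by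
  unfold LI
  rw [dif_pos ⟨u, hu⟩]
  have h := Exists.choose_spec (⟨u, hu⟩ : ∃ u, ∀ t ∈ Icc (0:ℝ) 1, Pr (fun a b => c (g a) (g b)) u t)
  have := Pr.const isPreconnected_Icc h hu (x0 := 0) (by simp) t ht
  grind

theorem LI_prim (hg : Continuous g) (hc : ∀ t ∈ Icc (0:ℝ) 1, LC c (g t)) :
    ∃ u, ∀ t ∈ Icc (0:ℝ) 1, Pr (fun a b => c (g a) (g b)) u t :=
  interval_prim _ fun t ht => (hc t ht).comp hg.continuousAt

theorem LI_pr (hg : Continuous g) (hc : ∀ t ∈ Icc (0:ℝ) 1, LC c (g t)) :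
    ∀ t ∈ Icc (0:ℝ) 1, Pr (fun a b => c (g a) (g b)) (LI c g) t := by
  intro t ht
  have h := LI_prim hg hc
  refine (h.choose_spec t ht).congr (k := h.choose 0) (Eventually.of_forall fun a => ?_)
  unfold LI
  rw [dif_pos h]

theorem LI_zero (hg : Continuous g) (hc : ∀ t ∈ Icc (0:ℝ) 1, LC c (g t)) : LI c g 0 = 0 := by
  obtain ⟨u, hu⟩ := LI_prim hg hc
  rw [LI_eq hu (by simp)]; grind

theorem LI_add (hg : Continuous g) (hc : ∀ t ∈ Icc (0:ℝ) 1, LC c (g t))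
    (hc' : ∀ t ∈ Icc (0:ℝ) 1, LC c' (g t)) {t : ℝ} (ht : t ∈ Icc (0:ℝ) 1) :
    LI (c + c') g t = LI c g t + LI c' g t := by
  obtain ⟨u, hu⟩ := LI_prim hg hc
  obtain ⟨u', hu'⟩ := LI_prim hg hc'
  rw [LI_eq hu ht, LI_eq hu' ht, LI_eq (c := c + c') (g := g) (u := u + u') (fun s hs => (hu s hs).add (hu' s hs)) ht]
  simp only [Pi.add_apply]; ring

theorem LI_cob (hg : Continuous g) {u : S → ZMod 2} (hc : ∀ t ∈ Icc (0:ℝ) 1, Pr c u (g t))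
    {t : ℝ} (ht : t ∈ Icc (0:ℝ) 1) : LI c g t = u (g t) + u (g 0) := by
  rw [LI_eq (u := u ∘ g) (fun s hs => (hc s hs).comp hg.continuousAt) ht]; rfl

theorem LI_congr (hg : Continuous g) (hc : ∀ t ∈ Icc (0:ℝ) 1, LC c (g t))
    (h : ∀ t ∈ Icc (0:ℝ) 1, Leq c' c (g t)) {t : ℝ} (ht : t ∈ Icc (0:ℝ) 1) :
    LI c' g t = LI c g t := by
  obtain ⟨u, hu⟩ := LI_prim hg hc
  rw [LI_eq hu ht, LI_eq (u := u) _ ht]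
  intro s hs
  obtain ⟨N, hN, h⟩ := h s hs
  exact (hu s hs).congrc (hg.continuousAt hN) fun a ha b hb => h _ ha _ hb
end LI

/-- clamped edges -/
noncomputable def ed {S : Type} [TopologicalSpace S] (G : EmbeddedGraph S) (i : ℕ) (t : ℝ) : S :=
  G.param i (projIcc (0:ℝ) 1 zero_le_one t)

section graph
variable {S : Type} [TopologicalSpace S] (G : EmbeddedGraph S)

theorem ed_eq (i : ℕ) {t : ℝ} (ht : t ∈ Icc (0:ℝ) 1) : ed G i t = G.param i t := by
  simp [ed, projIcc_of_mem _ ht]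

theorem ed_cont {i : ℕ} (hi : i ∈ G.edges) : Continuous (ed G i) :=
  (continuousOn_iff_continuous_domRestrict.1 (G.cont i hi)).comp continuous_projIcc

theorem ed_zero (i : ℕ) : ed G i 0 = G.param i 0 := ed_eq G i (by simp)
theorem ed_one (i : ℕ) : ed G i 1 = G.param i 1 := ed_eq G i (by simp)

theorem carrier_eq : G.carrier = (G.verts : Set S) ∪ ⋃ i ∈ (G.edges : Set ℕ), ed G i '' Icc 0 1 := by
  unfold EmbeddedGraph.carrier
  congr 1
  simp only [Finset.mem_coe]
  refine iUnion_congr fun i => iUnion_congr fun hi => ?_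
  exact image_congr fun t ht => (ed_eq G i ht).symm

theorem ed_mem {i : ℕ} (hi : i ∈ G.edges) {t : ℝ} (ht : t ∈ Icc (0:ℝ) 1) : ed G i t ∈ G.carrier := by
  rw [carrier_eq]
  exact Or.inr (mem_biUnion hi ⟨t, ht, rfl⟩)

theorem vert_mem {v : S} (hv : v ∈ G.verts) : v ∈ G.carrier := Or.inl hv

theorem carrier_compact : IsCompact G.carrier := by
  rw [carrier_eq]
  refine G.verts.finite_toSet.isCompact.union ?_
  exact G.edges.finite_toSet.isCompact_biUnion fun i hi => isCompact_Icc.image (ed_cont G hi)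

theorem taut_arc [T2Space S] {c : S → S → ZMod 2} {u : S → ZMod 2} {g : ℝ → S} (hg : Continuous g)
    {I : ℝ → ZMod 2} (hI : ∀ t ∈ Icc (0:ℝ) 1, Pr (fun a b => c (g a) (g b)) I t) (k : ZMod 2)
    (hu : ∀ t ∈ Icc (0:ℝ) 1, u (g t) = k + I t) (x : S) :
    ∀ᶠ a in 𝓝[g '' Icc 0 1] x, c a x = u a + u x := by
  rw [eventually_nhdsWithin_iff]
  have key : ∀ᶠ a in 𝓝 x, ∀ s ∈ Icc (0:ℝ) 1, g s = a → s ∈ Icc (0:ℝ) 1 → c a x = u a + u x := by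
    refine isCompact_Icc.eventually_forall_of_forall_eventually fun t ht => ?_
    by_cases hx : g t = x
    · subst hx
      obtain ⟨N, hN, h⟩ := hI t ht
      have : ∀ᶠ s in 𝓝 t, s ∈ N := hN
      rw [nhds_prod_eq]
      filter_upwards [this.prod_inr (𝓝 (g t))] with z hz h1 h2
      have h3 := h _ hz t (mem_of_mem_nhds hN)
      simp only at h3
      rw [← h1, hu _ h2, hu _ ht, h3]
      grind
    · have hop : IsOpen {z : S × ℝ | g z.2 ≠ z.1} := isOpen_ne_fun (by fun_prop) (by fun_prop)
      filter_upwards [hop.mem_nhds (x := (x, t)) hx] with z hz h1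
      exact absurd h1 hz
  filter_upwards [key] with a ha
  rintro ⟨s, hs, rfl⟩
  exact ha s hs rfl hs

theorem edge_prim [T2Space S] [TopologicalSpace.MetrizableSpace S] (hne : G.carrier.Nonempty)
    {c : S → S → ZMod 2} (hc : ∀ x ∈ G.carrier, LC c x) (w : S → ZMod 2)
    (hw : ∀ i ∈ G.edges, LI c (ed G i) 1 = w (G.param i 0) + w (G.param i 1)) :
    ∃ u, (∀ x ∈ G.carrier, Pr c u x) ∧ (∀ v ∈ G.verts, u v = w v) ∧
      (∀ i ∈ G.edges, ∀ t ∈ Icc (0:ℝ) 1, u (ed G i t) = w (G.param i 0) + LI c (ed G i) t) ∧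
      ∀ y ∈ G.carrier, (∀ᶠ a in 𝓝[G.carrier] y, u a = 0) → Pr c 0 y → ∀ᶠ a in 𝓝 y, u a = 0 := by
  classical
  let u : S → ZMod 2 := fun a => if a ∈ G.verts then w a else
    if h : ∃ p : ℕ × ℝ, p.1 ∈ G.edges ∧ p.2 ∈ Ioo (0:ℝ) 1 ∧ G.param p.1 p.2 = a then
      w (G.param h.choose.1 0) + LI c (ed G h.choose.1) h.choose.2 else 0
  have hcI : ∀ i ∈ G.edges, ∀ t ∈ Icc (0:ℝ) 1, LC c (ed G i t) := fun i hi t ht => hc _ (ed_mem G hi ht)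
  have huv : ∀ v ∈ G.verts, u v = w v := fun v hv => by simp [u, hv]
  have hue : ∀ i ∈ G.edges, ∀ t ∈ Icc (0:ℝ) 1, u (ed G i t) = w (G.param i 0) + LI c (ed G i) t := by
    intro i hi t ht
    by_cases h0 : t = 0
    · subst h0
      rw [ed_zero, huv _ (G.endpoint₀ i hi), LI_zero (ed_cont G hi) (hcI i hi), add_zero]
    by_cases h1 : t = 1
    · subst h1
      rw [ed_one, huv _ (G.endpoint₁ i hi), hw i hi]
      grind
    have htt : t ∈ Ioo (0:ℝ) 1 := ⟨lt_of_le_of_ne ht.1 (Ne.symm h0), lt_of_le_of_ne ht.2 h1⟩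
    have hnv : ed G i t ∉ G.verts := by
      rw [ed_eq G i ht]; exact G.interior_avoids_verts i hi t htt
    have h : ∃ p : ℕ × ℝ, p.1 ∈ G.edges ∧ p.2 ∈ Ioo (0:ℝ) 1 ∧ G.param p.1 p.2 = ed G i t :=
      ⟨(i, t), hi, htt, (ed_eq G i ht).symm⟩
    simp only [u, hnv, if_false]
    rw [dif_pos h]
    obtain ⟨k1, k2, k3⟩ := h.choose_spec
    replace k3 := k3.trans (ed_eq G i ht)
    have e1 : h.choose.1 = i := by
      by_contra hne
      exact G.interiors_disjoint _ k1 i hi hne _ k2 _ htt k3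
    have e2 : h.choose.2 = t := by
      rw [e1] at k3
      exact G.inj i hi ⟨k2.1.le, k2.2⟩ ⟨htt.1.le, htt.2⟩ k3
    rw [e1, e2]
  have htaut : ∀ x ∈ G.carrier, ∀ᶠ a in 𝓝[G.carrier] x, c a x = u a + u x := by
    intro x hx
    rw [carrier_eq, nhdsWithin_union, eventually_sup]
    constructor
    · rw [eventually_nhdsWithin_iff]
      have hfin : ((G.verts : Set S) \ {x}).Finite := G.verts.finite_toSet.subset sdiff_subset
      filter_upwards [hfin.isClosed.isOpen_compl.mem_nhds (by simp)] with a ha hav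
      have : a = x := by
        by_contra hne
        exact ha ⟨hav, hne⟩
      subst this
      rw [(hc a hx).diag]; grind
    · rw [nhdsWithin_biUnion G.edges.finite_toSet, eventually_iSup]
      intro i
      rw [eventually_iSup]
      intro hi
      exact taut_arc (ed_cont G hi) (LI_pr (ed_cont G hi) (hcI i hi)) _ (hue i hi) x
  obtain ⟨u', h1, h2, h3⟩ := taut (carrier_compact G) hne hc htaut
  refine ⟨u', h1, fun v hv => by rw [h2 v (vert_mem G hv), huv v hv],
    fun i hi t ht => by rw [h2 _ (ed_mem G hi ht), hue i hi t ht], fun y hy hz => h3 y hy ?_⟩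
  filter_upwards [hz, self_mem_nhdsWithin] with a ha haG
  rw [← h2 a haG, ha]

end graph
end EG
end
section
open Set Filter Topology
namespace EG

section faces
variable {S : Type} [TopologicalSpace S] (G : EmbeddedGraph S)

theorem carrier_compl_open [T2Space S] : IsOpen G.carrierᶜ := (carrier_compact G).isClosed.isOpen_compl

/-- faces as subsets of `S` -/
def face (x : S) : Set S := connectedComponentIn G.carrierᶜ x

theorem face_open [T2Space S] [LocallyConnectedSpace S] (x : S) : IsOpen (face G x) :=
  (carrier_compl_open G).connectedComponentIn

theorem face_sub (x : S) : face G x ⊆ G.carrierᶜ := connectedComponentIn_subset _ _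

theorem face_pre (x : S) : IsPreconnected (face G x) := isPreconnected_connectedComponentIn

theorem face_self {x : S} (hx : x ∉ G.carrier) : x ∈ face G x := mem_connectedComponentIn hx

theorem face_eq {x y : S} (h : y ∈ face G x) : face G x = face G y := connectedComponentIn_eq h

theorem mem_face_iff (a b : ↥(G.carrierᶜ)) : (b : S) ∈ face G a ↔ (b : ConnectedComponents ↥(G.carrierᶜ)) = a := by
  unfold face
  rw [connectedComponentIn_eq_image a.2, ConnectedComponents.coe_eq_coe']
  constructor
  · rintro ⟨b', h, e⟩
    rwa [← Subtype.ext e]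
  · intro h; exact ⟨b, h, rfl⟩

theorem face_dec [T2Space S] [LocallyConnectedSpace S] (x y : S) :
    y ∈ face G x ∨ y ∈ G.carrier ∨ ∃ N ∈ 𝓝 y, Disjoint N (face G x) := by
  by_cases h1 : y ∈ G.carrier
  · exact Or.inr (Or.inl h1)
  by_cases h2 : y ∈ face G x
  · exact Or.inl h2
  · refine Or.inr (Or.inr ⟨face G y, (face_open G y).mem_nhds (face_self G h1), ?_⟩)
    rw [Set.disjoint_left]
    intro a ha hb
    apply h2
    rw [face_eq G hb, ← face_eq G ha]
    exact face_self G h1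

/-- finitely many conditions -/
theorem fin_cond [T2Space S] (B1 B2 : Set S) (hB1 : IsClosed B1) (hB2 : IsOpen B2) (h12 : B1 ⊆ B2) :
    ∃ C : Set (ℕ × ℝ), C.Finite ∧ (∀ p ∈ C, p.1 ∈ G.edges ∧ p.2 ∈ Icc (0:ℝ) 1) ∧ ∀ c : S → S → ZMod 2,
      (∀ x ∈ G.carrier, LC c x) → (∀ x ∉ B1, Pr c 0 x) → (∀ p ∈ C, LI c (ed G p.1) p.2 = 0) →
      ∀ i ∈ G.edges, LI c (ed G i) 1 = 0 ∧ ∀ t ∈ Icc (0:ℝ) 1, ed G i t ∉ B2 → LI c (ed G i) t = 0 := by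
  classical
  have one : ∀ i ∈ G.edges, ∃ T : Set ℝ, T.Finite ∧ T ⊆ Icc (0:ℝ) 1 ∧ ∀ c : S → S → ZMod 2,
      (∀ x ∈ G.carrier, LC c x) → (∀ x ∉ B1, Pr c 0 x) → (∀ t ∈ T, LI c (ed G i) t = 0) →
      ∀ t ∈ Icc (0:ℝ) 1, ed G i t ∉ B2 → LI c (ed G i) t = 0 := by
    intro i hi
    have hg := ed_cont G hi
    have hK : IsCompact (Icc (0:ℝ) 1 ∩ ed G i ⁻¹' B2ᶜ) :=
      isCompact_Icc.inter_right (hB2.isClosed_compl.preimage hg)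
    have hr : ∀ t : ℝ, ∃ r > 0, ed G i t ∉ B2 → Metric.ball t r ⊆ ed G i ⁻¹' B1ᶜ := by
      intro t
      by_cases ht : ed G i t ∈ B2
      · exact ⟨1, one_pos, fun h => absurd ht h⟩
      · obtain ⟨r, hr, h⟩ := Metric.mem_nhds_iff.1
          ((hB1.isOpen_compl.preimage hg).mem_nhds (show t ∈ ed G i ⁻¹' B1ᶜ from fun h => ht (h12 h)))
        exact ⟨r, hr, fun _ => h⟩
    choose r hr0 hr using hr
    obtain ⟨T, hT, hcov⟩ := hK.elim_nhds_subcover (fun t => Metric.ball t (r t))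
      (fun t _ => Metric.ball_mem_nhds t (hr0 t))
    refine ⟨T, T.finite_toSet, fun t ht => (hT t ht).1, ?_⟩
    intro c hc hc0 hz t ht htB
    obtain ⟨s, hs, hts⟩ : ∃ s ∈ T, t ∈ Metric.ball s (r s) := by
      simpa using hcov ⟨ht, htB⟩
    have hs' := hT s hs
    have hconv : Convex ℝ (Metric.ball s (r s) ∩ Icc (0:ℝ) 1) := (convex_ball _ _).inter (convex_Icc _ _)
    have := Pr.const hconv.isPreconnected (c := fun a b => c (ed G i a) (ed G i b)) (u := 0)
      (u' := LI c (ed G i)) (x0 := s)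
      (fun y hy => (hc0 _ (hr s hs'.2 hy.1)).comp hg.continuousAt)
      (fun y hy => LI_pr hg (fun t ht => hc _ (ed_mem G hi ht)) y hy.2)
      ⟨Metric.mem_ball_self (hr0 s), hs'.1⟩ t ⟨hts, ht⟩
    rw [this, hz s hs]; simp
  choose! T hT1 hT2 hT3 using one
  refine ⟨⋃ i ∈ (G.edges : Set ℕ), Prod.mk i '' insert 1 (T i), ?_, ?_, ?_⟩
  · exact G.edges.finite_toSet.biUnion fun i hi => ((hT1 i hi).insert 1).image _
  · intro p hp
    simp only [mem_iUnion] at hp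
    obtain ⟨i, hi, t, ht, rfl⟩ := hp
    refine ⟨hi, ?_⟩
    rcases ht with rfl | ht
    · simp
    · exact hT2 i hi ht
  · intro c hc hc0 hz i hi
    have hz' : ∀ t ∈ insert 1 (T i), LI c (ed G i) t = 0 := fun t ht =>
      hz (i, t) (mem_biUnion (show i ∈ (G.edges : Set ℕ) from hi) ⟨t, ht, rfl⟩)
    exact ⟨hz' 1 (by simp), hT3 i hi c hc hc0 (fun t ht => hz' t (by simp [ht]))⟩

/-- two punctures in a disc, separated by the graph, with all conditions trivial: impossible -/
theorem no_single [T2Space S] [TopologicalSpace.MetrizableSpace S] [LocallyConnectedSpace S]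
    (hne : G.carrier.Nonempty) {φ : ℝ × ℝ → S} (hφ : IsOpenEmbedding φ)
    {c : S → S → ZMod 2} {q : S} (hq : q ∈ φ '' Metric.ball 0 1) (hqG : q ∉ G.carrier)
    (hc : ∀ x ∈ G.carrier, LC c x) (hc' : ∀ x ∈ face G q, x ≠ q → LC c x)
    (hc0 : ∀ x ∉ φ '' Metric.closedBall 0 1, Pr c 0 x)
    (hI : ∀ i ∈ G.edges, LI c (ed G i) 1 = 0 ∧
      ∀ t ∈ Icc (0:ℝ) 1, ed G i t ∉ φ '' Metric.ball 0 2 → LI c (ed G i) t = 0) : EX c q := by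
  classical
  obtain ⟨z, hz, rfl⟩ := hq
  obtain ⟨u, hu1, hu2, hu3, hu4⟩ := edge_prim G hne hc 0 (fun i hi => by simp [(hI i hi).1])
  set U := face G (φ z) with hU
  have hUo : IsOpen U := face_open G _
  have hqU : φ z ∈ U := face_self G hqG
  let d : S → S → ZMod 2 := fun a b => if a ∈ U ∧ b ∈ U then c a b + u a + u b else 0
  let v : S → ZMod 2 := fun a => if a ∈ U then u a else 0
  have hdU : ∀ y ∈ U, Leq d (fun a b => c a b + u a + u b) y := fun y hy =>
    ⟨U, hUo.mem_nhds hy, fun a ha b hb => by simp [d, ha, hb]⟩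
  have hdG : ∀ y ∈ G.carrier, Pr d 0 y := by
    intro y hy
    obtain ⟨N, hN, h⟩ := hu1 y hy
    refine ⟨N, hN, fun a ha b hb => ?_⟩
    simp only [d, h a ha b hb]
    split_ifs
    · simp; grind
    · simp
  have hdd : ∀ y, ∀ N ∈ 𝓝 y, Disjoint N U → Pr d 0 y := by
    intro y N hN hd
    refine ⟨N, hN, fun a ha b hb => ?_⟩
    simp [d, Set.disjoint_left.1 hd ha]
  have hdl : ∀ y, y ≠ φ z → LC d y := by
    intro y hy
    rcases face_dec G (φ z) y with h | h | ⟨N, hN, h⟩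
    · refine (hdU y h).lc ?_
      obtain ⟨w, hw⟩ := hc' y h hy
      exact ⟨_, hw.addCob u⟩
    · exact ⟨_, hdG y h⟩
    · exact ⟨_, hdd y N hN h⟩
  have hclosed : IsClosed (φ '' Metric.closedBall (0:ℝ×ℝ) 2) :=
    ((isCompact_closedBall _ _).image hφ.continuous).isClosed
  have hdv : ∀ y ∉ φ '' Metric.closedBall (0:ℝ×ℝ) 2, Pr d v y := by
    intro y hy
    have hy1 : Pr c 0 y := hc0 y (fun h => hy (image_mono (Metric.closedBall_subset_closedBall (by norm_num)) h))
    rcases face_dec G (φ z) y with h | h | ⟨N, hN, h⟩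
    · refine (hdU y h).pr ?_
      refine (hy1.addCob u).congr0 ?_
      filter_upwards [hUo.mem_nhds h] with a ha
      have ha2 : v a = u a := if_pos ha
      rw [ha2]; simp
    · refine (hdG y h).congr0 ?_
      have hev : ∀ᶠ a in 𝓝 y, u a = 0 := by
        refine hu4 y h ?_ hy1
        rw [eventually_nhdsWithin_iff]
        filter_upwards [hclosed.isOpen_compl.mem_nhds hy] with a ha haG
        rw [carrier_eq] at haG
        rcases haG with haG | haG
        · simp [hu2 a haG]
        · simp only [mem_iUnion] at haG
          obtain ⟨i, hi, t, ht, rfl⟩ := haG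
          rw [hu3 i hi t ht, (hI i hi).2 t ht]
          · simp
          · exact fun h => ha (image_mono Metric.ball_subset_closedBall h)
      filter_upwards [hev] with a ha
      simp [v, ha]
    · refine (hdd y N hN h).congr0 ?_
      filter_upwards [hN] with a ha
      exact if_neg (Set.disjoint_left.1 h ha)
  -- planar argument
  let ψ : ℝ × ℝ → S := fun y => φ (y + z)
  have hψ : IsOpenEmbedding ψ := hφ.comp (Homeomorph.addRight z).isOpenEmbedding
  have hψ0 : ψ 0 = φ z := by simp [ψ]
  obtain ⟨v', hv', -⟩ := plane_ext 3 (by norm_num) (fun a b => d (ψ a) (ψ b))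
    (fun y hy => (hdl (ψ y) (by rw [← hψ0]; exact fun h => hy (hψ.injective h))).comp hψ.continuous.continuousAt)
    (v ∘ ψ) (fun y hy => (hdv (ψ y) (by
      rintro ⟨p, hp, hpe⟩
      have e := hφ.injective hpe
      rw [e] at hp
      simp only [Metric.mem_closedBall, Metric.mem_ball, Prod.dist_eq, Real.dist_eq, Prod.fst_zero, Prod.snd_zero,
        sub_zero, max_lt_iff, max_le_iff, Prod.fst_add, Prod.snd_add, abs_lt, abs_le] at hp hz
      rcases hy with h | h <;> rw [lt_abs] at h <;> rcases h with h | h <;>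
        linarith [hp.1.1, hp.1.2, hp.2.1, hp.2.2, hz.1.1, hz.1.2, hz.2.1, hz.2.2])).comp hψ.continuous.continuousAt)
  have hEX : EX d (φ z) := by
    rw [← hψ0]
    refine ex_push hψ ⟨v', ?_⟩
    filter_upwards [self_mem_nhdsWithin] with y hy using hv' y hy
  obtain ⟨w, hw⟩ := hEX
  refine ⟨w + u, ?_⟩
  filter_upwards [hw, mem_nhdsWithin_of_mem_nhds (hUo.mem_nhds hqU)] with y hy hyU
  have h1 := ((hdU y hyU).symm.pr hy).addCob u
  refine h1.congrc univ_mem fun a _ b _ => ?_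
  grind

theorem fin_faces [T2Space S] [CompactSpace S] (hS : Surf S) (hne : G.carrier.Nonempty) :
    Finite (ConnectedComponents ↥(G.carrierᶜ)) := by
  classical
  by_contra hinf
  rw [not_finite_iff_infinite] at hinf
  haveI := hS.metrizable
  haveI := hS.locConn
  let rep : ConnectedComponents ↥(G.carrierᶜ) → S := fun C => (Quotient.out C : ↥(G.carrierᶜ))
  have hrepG : ∀ C, rep C ∉ G.carrier := fun C => (Quotient.out C).2
  have hmk : ∀ C : ConnectedComponents ↥(G.carrierᶜ), ((Quotient.out C : ↥(G.carrierᶜ)) : ConnectedComponents ↥(G.carrierᶜ)) = C :=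
    fun C => Quotient.out_eq C
  have hrep : ∀ C C', rep C' ∈ face G (rep C) → C' = C := by
    intro C C' h
    have := (mem_face_iff G (Quotient.out C) (Quotient.out C')).1 h
    rwa [hmk, hmk] at this
  have hinj : Function.Injective rep := fun C C' h => by
    symm; apply hrep; rw [← h]; exact face_self G (hrepG _)
  have hTinf : (range rep).Infinite := infinite_range_of_injective hinj
  choose φ hφ h0 using hS
  have hopen : ∀ x, IsOpen (φ x '' Metric.ball 0 1) := fun x => (hφ x).isOpenMap _ Metric.isOpen_ball
  obtain ⟨t, ht⟩ := isCompact_univ.elim_finite_subcover (fun x => φ x '' Metric.ball 0 1) hopen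
    (fun x _ => mem_iUnion.2 ⟨x, 0, Metric.mem_ball_self one_pos, h0 x⟩)
  obtain ⟨x, hx⟩ : ∃ x, (rep ⁻¹' (φ x '' Metric.ball 0 1)).Infinite := by
    by_contra hcon
    push Not at hcon
    apply Set.infinite_univ (α := ConnectedComponents ↥(G.carrierᶜ))
    refine (t.finite_toSet.biUnion fun x _ => hcon x).subset ?_
    intro C _
    have := ht (mem_univ (rep C))
    simpa using this
  set D := φ x '' Metric.ball 0 1 with hD
  have hDpre : IsPreconnected D := (convex_ball _ _).isPreconnected.image _ (hφ x).continuous.continuousOn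
  obtain ⟨C0, hC0⟩ := hx.nonempty
  have hx' : (rep ⁻¹' D \ {C0}).Infinite := hx.diff (finite_singleton C0)
  have hm : ∀ C : ↥(rep ⁻¹' D \ {C0}), ∃ m : S → S → ZMod 2, (∀ y, y ≠ rep C0 → y ≠ rep C → LC m y) ∧
      ¬ EX m (rep C0) ∧ ¬ EX m (rep C) ∧ ∀ y ∉ D, Pr m 0 y := by
    intro C
    rcases move (fun x => ⟨φ x, hφ x, h0 x⟩) (hopen x) hDpre hC0 C.2.1 with h | h
    · exact absurd (hinj h).symm C.2.2
    · exact h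
  choose m hm1 hm2 hm3 hm4 using hm
  obtain ⟨K, hKf, hK1, hK2⟩ := fin_cond G (φ x '' Metric.closedBall 0 1) (φ x '' Metric.ball 0 2)
    ((isCompact_closedBall _ _).image (hφ x).continuous).isClosed ((hφ x).isOpenMap _ Metric.isOpen_ball)
    (image_mono (Metric.closedBall_subset_ball (by norm_num)))
  haveI : Infinite ↥(rep ⁻¹' D \ {C0}) := hx'.to_subtype
  haveI : Finite K := hKf
  obtain ⟨C1, C2, hne12, heq⟩ := Finite.exists_ne_map_eq_of_infinite
    (fun C : ↥(rep ⁻¹' D \ {C0}) => fun p : K => LI (m C) (ed G p.1.1) p.1.2)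
  have hLCG : ∀ C, ∀ y ∈ G.carrier, LC (m C) y := fun C y hy => hm1 C y
    (by rintro rfl; exact hrepG _ hy) (by rintro rfl; exact hrepG _ hy)
  have hC12 : (C1 : ConnectedComponents ↥(G.carrierᶜ)) ≠ C2 := fun h => hne12 (Subtype.ext h)
  have hc0 : ∀ y ∉ φ x '' Metric.closedBall 0 1, Pr (m C1 + m C2) 0 y := by
    intro y hy
    have hyD : y ∉ D := fun h => hy (image_mono Metric.ball_subset_closedBall h)
    simpa using (hm4 C1 y hyD).add (hm4 C2 y hyD)
  have hcG : ∀ y ∈ G.carrier, LC (m C1 + m C2) y := fun y hy => (hLCG C1 y hy).add (hLCG C2 y hy)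
  have hex : EX (m C1 + m C2) (rep C1) := by
    refine no_single G hne (hφ x) C1.2.1 (hrepG _) hcG ?_ hc0 (hK2 _ hcG hc0 ?_)
    · intro y hy hy1
      have hy0 : y ≠ rep C0 := by rintro rfl; exact C1.2.2 (hrep _ _ hy).symm
      have hy2 : y ≠ rep C2 := by rintro rfl; exact hC12 (hrep _ _ hy).symm
      exact (hm1 C1 y hy0 hy1).add (hm1 C2 y hy0 hy2)
    · intro p hp
      obtain ⟨h1, h2⟩ := hK1 p hp
      rw [LI_add (ed_cont G h1) (fun t ht => hLCG _ _ (ed_mem G h1 ht)) (fun t ht => hLCG _ _ (ed_mem G h1 ht)) h2]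
      have := congrFun heq ⟨p, hp⟩
      simp only at this
      rw [this]; grind
  apply hm3 C1
  have h2 : LC (m C2) (rep C1) := hm1 C2 _ (fun h => C1.2.2 (hinj h)) (fun h => hC12 (hinj h))
  have := hex.add h2.ex
  rwa [addcancel'] at this
end faces
end EG
end
section
open Set Filter Topology
namespace EG

section counting
variable {S : Type} [TopologicalSpace S]

theorem neg_coch (c : S → S → ZMod 2) : -c = c := by
  funext a b; simp [ZMod.neg_eq_self_mod_two]

/-- cocycles on `W` -/
def Zc (W : Set S) : AddSubgroup (S → S → ZMod 2) where
  carrier := {c | ∀ x ∈ W, LC c x}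
  add_mem' := fun ha hb x hx => (ha x hx).add (hb x hx)
  zero_mem' := fun x _ => LC.zero
  neg_mem' := fun {c} hc => by rw [neg_coch]; exact hc

/-- coboundaries on `W` -/
def Bc (W : Set S) : AddSubgroup (S → S → ZMod 2) where
  carrier := {c | ∃ u, ∀ x ∈ W, Pr c u x}
  add_mem' := by
    rintro a b ⟨u, hu⟩ ⟨v, hv⟩
    exact ⟨u + v, fun x hx => (hu x hx).add (hv x hx)⟩
  zero_mem' := ⟨0, fun x _ => Pr.zero⟩
  neg_mem' := fun {c} hc => by rw [neg_coch]; exact hc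

/-- cocycles on the punctured set extending over the puncture -/
def Ec (W : Set S) (p : S) : AddSubgroup (S → S → ZMod 2) where
  carrier := {c | (∀ x ∈ W, x ≠ p → LC c x) ∧ EX c p}
  add_mem' := fun ha hb => ⟨fun x hx hp => (ha.1 x hx hp).add (hb.1 x hx hp), ha.2.add hb.2⟩
  zero_mem' := ⟨fun x _ _ => LC.zero, LC.zero.ex⟩
  neg_mem' := fun {c} hc => by rw [neg_coch]; exact hc

theorem mem_Zc {W : Set S} {c} : c ∈ Zc W ↔ ∀ x ∈ W, LC c x := Iff.rfl
theorem mem_Bc {W : Set S} {c} : c ∈ Bc W ↔ ∃ u, ∀ x ∈ W, Pr c u x := Iff.rfl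
theorem mem_Ec {W : Set S} {p} {c} : c ∈ Ec W p ↔ (∀ x ∈ W, x ≠ p → LC c x) ∧ EX c p := Iff.rfl

theorem Bc_le_Zc (W : Set S) : Bc W ≤ Zc W := by
  rintro c ⟨u, hu⟩ x hx
  exact ⟨u, hu x hx⟩

theorem Ec_eq [T2Space S] [RegularSpace S] {W : Set S} (hW : IsOpen W) {p : S} (hp : p ∈ W) :
    Ec W p = Zc W ⊔ Bc (W \ {p}) := by
  apply le_antisymm
  · rintro c ⟨h1, h2⟩
    obtain ⟨c', hc', -, v, hv⟩ := fix h2 univ_mem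
    have e : c = c' + (c + c') := by
      rw [add_comm c c', ← add_assoc, addself, zero_add]
    rw [e]
    refine AddSubgroup.add_mem_sup ?_ ?_
    · intro x hx
      by_cases hxp : x = p
      · rwa [hxp]
      · have h3 : LC (c + (c + c')) x := (h1 x hx hxp).add ⟨v, hv x hxp⟩
        rwa [addcancel] at h3
    · exact ⟨v, fun x hx => hv x hx.2⟩
  · refine sup_le ?_ ?_
    · intro c hc
      exact ⟨fun x hx _ => hc x hx, (hc p hp).ex⟩
    · rintro c ⟨u, hu⟩
      refine ⟨fun x hx hxp => ⟨u, hu x ⟨hx, hxp⟩⟩, u, ?_⟩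
      filter_upwards [self_mem_nhdsWithin, mem_nhdsWithin_of_mem_nhds (hW.mem_nhds hp)] with x h1 h2
      exact hu x ⟨h2, h1⟩

theorem Bc_inf [T1Space S] (hS : Surf S) {W : Set S} (hW : IsOpen W) {p : S} (hp : p ∈ W) :
    Bc (W \ {p}) ⊓ Zc W = Bc W := by
  apply le_antisymm
  · rintro c ⟨⟨u, hu⟩, hz⟩
    obtain ⟨u', h, -⟩ := fill_one hS hW hp (hz p hp) (fun y hy hyp => hu y ⟨hy, hyp⟩)
    exact ⟨u', h⟩
  · intro c hc
    refine ⟨?_, Bc_le_Zc W hc⟩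
    obtain ⟨u, hu⟩ := hc
    exact ⟨u, fun x hx => hu x hx.1⟩

theorem Ec_index (hS : Surf S) {W : Set S} (hW : IsOpen W) {p : S} (hp : p ∈ W)
    (hex : ∃ c ∈ Zc (W \ {p}), ¬ EX c p) : (Ec W p).relIndex (Zc (W \ {p})) = 2 := by
  obtain ⟨m, hm, hmE⟩ := hex
  have hev : ∀ c ∈ Zc (W \ {p}), ∀ᶠ y in 𝓝[≠] p, LC c y := by
    intro c hc
    filter_upwards [self_mem_nhdsWithin, mem_nhdsWithin_of_mem_nhds (hW.mem_nhds hp)] with x h1 h2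
    exact hc x ⟨h2, h1⟩
  rw [AddSubgroup.relIndex, AddSubgroup.index_eq_two_iff]
  refine ⟨⟨m, hm⟩, fun ⟨b, hb⟩ => ?_⟩
  have key : ∀ c ∈ Zc (W \ {p}), c ∈ Ec W p ↔ EX c p := fun c hc =>
    ⟨fun h => h.2, fun h => ⟨fun x hx hxp => hc x ⟨hx, hxp⟩, h⟩⟩
  have e1 : ((⟨b, hb⟩ + ⟨m, hm⟩ : Zc (W \ {p})) ∈ (Ec W p).addSubgroupOf (Zc (W \ {p}))) ↔ EX (b + m) p := by
    rw [AddSubgroup.mem_addSubgroupOf]; exact key _ (add_mem hb hm)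
  have e2 : ((⟨b, hb⟩ : Zc (W \ {p})) ∈ (Ec W p).addSubgroupOf (Zc (W \ {p}))) ↔ EX b p := by
    rw [AddSubgroup.mem_addSubgroupOf]; exact key _ hb
  rw [e1, e2]
  by_cases h : EX b p
  · refine Or.inr ⟨h, fun h' => hmE ?_⟩
    have := h.add h'
    rwa [addcancel] at this
  · refine Or.inl ⟨?_, h⟩
    rcases codim hS b m p (hev b hb) (hev m hm) with h1 | h1 | h1
    · exact absurd h1 h
    · exact absurd h1 hmE
    · exact h1

/-- order of first cohomology -/
noncomputable def HH (P : Set S) : ℕ := (Bc Pᶜ).relIndex (Zc Pᶜ)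

theorem HH_insert [T2Space S] [RegularSpace S] [ConnectedSpace S] (hS : Surf S) {P : Set S} (hP : P.Finite)
    (hne : P.Nonempty) {p : S} (hp : p ∉ P) : HH (insert p P) = HH P * 2 := by
  have hW : IsOpen Pᶜ := hP.isClosed.isOpen_compl
  have e : (insert p P)ᶜ = Pᶜ \ {p} := by
    ext x; simp [not_or, and_comm]
  have hle1 : Bc (Pᶜ \ {p}) ≤ Ec Pᶜ p := by rw [Ec_eq hW hp]; exact le_sup_right
  have hle2 : Ec Pᶜ p ≤ Zc (Pᶜ \ {p}) := fun c hc x hx => hc.1 x hx.1 hx.2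
  unfold HH
  rw [e, ← AddSubgroup.relIndex_mul_relIndex _ _ _ hle1 hle2, Ec_index hS hW hp, Ec_eq hW hp,
    AddSubgroup.relIndex_sup_right, ← AddSubgroup.inf_relIndex_right, Bc_inf hS hW hp]
  obtain ⟨q, hq⟩ := hne
  rcases move hS isOpen_univ isPreconnected_univ (mem_univ p) (mem_univ q) with h | ⟨m, h1, h2, -, -⟩
  · exact absurd (h ▸ hq) hp
  · exact ⟨m, fun x hx => h1 x hx.2 (fun h => hx.1 (h ▸ hq)), h2⟩

theorem HH_union [T2Space S] [RegularSpace S] [ConnectedSpace S] (hS : Surf S) {P : Set S} (hP : P.Finite)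
    (hne : P.Nonempty) {Q : Set S} (hQ : Q.Finite) : HH (P ∪ Q) = HH P * 2 ^ (Q \ P).ncard := by
  classical
  induction Q, hQ using Set.Finite.induction_on with
  | empty => simp
  | @insert a s ha hs ih =>
    by_cases haP : a ∈ P
    · rw [show P ∪ insert a s = P ∪ s by ext; simp; grind, ih, insert_sdiff_of_mem _ haP]
    · rw [show P ∪ insert a s = insert a (P ∪ s) by rw [union_insert],
        HH_insert hS (hP.union hs) (hne.mono subset_union_left) (by simp [haP, ha]), ih,
        insert_sdiff_of_notMem _ haP, ncard_insert_of_notMem (by simp [ha]) (hs.subset sdiff_subset), pow_succ, mul_assoc]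

theorem HH_compare [T2Space S] [RegularSpace S] [ConnectedSpace S] (hS : Surf S) {P Q : Set S} (hP : P.Finite)
    (hneP : P.Nonempty) (hQ : Q.Finite) (hneQ : Q.Nonempty) :
    HH P * 2 ^ Q.ncard = HH Q * 2 ^ P.ncard := by
  have h1 := HH_union hS hP hneP hQ
  have h2 := HH_union hS hQ hneQ hP
  rw [union_comm, h1] at h2
  have e1 := ncard_inter_add_ncard_sdiff_eq_ncard Q P hQ
  have e2 := ncard_inter_add_ncard_sdiff_eq_ncard P Q hP
  rw [inter_comm] at e2
  rw [← e1, ← e2, pow_add, pow_add]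
  calc _ = (HH P * 2 ^ (Q \ P).ncard) * 2 ^ (Q ∩ P).ncard := by ring
    _ = _ := by rw [h2]; ring

end counting

section algebra
variable {A B C : Type*} [AddCommGroup A] [AddCommGroup B] [AddCommGroup C]

theorem count_lower [Finite B] [Finite C] (K : AddSubgroup A) (hK : K.index ≠ 0) (f : A →+ C) (hf : Function.Surjective f)
    (d : B →+ C) (h : ∀ a ∈ K, f a ∈ d.range) (hker : 2 ≤ Nat.card d.ker) :
    Nat.card C * 2 ≤ K.index * Nat.card B := by
  have h1 : (d.range.comap f).index ∣ K.index := AddSubgroup.index_dvd_of_le h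
  rw [AddSubgroup.index_comap_of_surjective _ hf] at h1
  have h2 := Nat.le_of_dvd (Nat.pos_of_ne_zero hK) h1
  rw [← AddSubgroup.card_mul_index d.range, ← AddSubgroup.card_mul_index d.ker, AddSubgroup.index_ker]
  calc _ ≤ (Nat.card d.range * K.index) * Nat.card d.ker := by gcongr
    _ = _ := by ring

theorem count_upper [Finite B] [Finite C] (K : AddSubgroup A) (f : A →+ C)
    (d : B →+ C) (h : ∀ a, f a ∈ d.range → a ∈ K) (hker : Nat.card d.ker ≤ 2) :
    K.index ≠ 0 ∧ K.index * Nat.card B ≤ Nat.card C * 2 := by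
  have h1 : K.index ∣ (d.range.comap f).index := AddSubgroup.index_dvd_of_le h
  rw [AddSubgroup.index_comap] at h1
  have h3 := h1.trans (AddSubgroup.relIndex_dvd_index_of_normal _ _)
  have h4 : d.range.index ≠ 0 := AddSubgroup.index_ne_zero_of_finite
  have h2 := Nat.le_of_dvd (Nat.pos_of_ne_zero h4) h3
  refine ⟨fun h0 => h4 (by rw [h0] at h3; simpa using h3), ?_⟩
  rw [← AddSubgroup.card_mul_index d.range, ← AddSubgroup.card_mul_index d.ker, AddSubgroup.index_ker]
  calc _ ≤ d.range.index * (2 * Nat.card d.range) := by gcongr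
    _ = _ := by ring
end algebra

section graphs
variable {S : Type} [TopologicalSpace S] (G : EmbeddedGraph S)

/-- coboundary of the graph -/
def dl : (↥G.verts → ZMod 2) →+ (↥G.edges → ZMod 2) where
  toFun w i := w ⟨_, G.endpoint₀ i i.2⟩ + w ⟨_, G.endpoint₁ i i.2⟩
  map_zero' := by funext i; simp
  map_add' := by intro a b; funext i; simp; abel

/-- the period map of cocycles defined near the graph -/
noncomputable def per (W : Set S) (hW : G.carrier ⊆ W) : ↥(Zc W) →+ (↥G.edges → ZMod 2) where
  toFun c i := LI c.1 (ed G i) 1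
  map_zero' := by
    funext i
    have h := LI_cob (c := (0 : S → S → ZMod 2)) (u := 0) (ed_cont G i.2) (fun t _ => Pr.zero) (t := 1) (by simp)
    simpa using h
  map_add' := by
    intro a b; funext i
    exact LI_add (ed_cont G i.2) (fun t ht => a.2 _ (hW (ed_mem G i.2 ht)))
      (fun t ht => b.2 _ (hW (ed_mem G i.2 ht))) (by simp)

theorem lower_bound [Nonempty ↥G.verts] {P : Set S} (hP : G.carrier ⊆ Pᶜ) (h0 : HH P ≠ 0)
    (h : ∀ i ∈ G.edges, ∃ c ∈ Zc Pᶜ, ∀ j ∈ G.edges, LI c (ed G j) 1 = if j = i then 1 else 0) :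
    2 ^ G.edges.card * 2 ≤ HH P * 2 ^ G.verts.card := by
  classical
  have key := count_lower ((Bc Pᶜ).addSubgroupOf (Zc Pᶜ)) h0 (per G Pᶜ hP) ?_ (dl G) ?_ ?_
  · simpa [HH, AddSubgroup.relIndex] using key
  · choose! c hc hcj using h
    intro f
    refine ⟨∑ i : ↥G.edges, if f i = 1 then ⟨c i, hc i i.2⟩ else 0, ?_⟩
    rw [map_sum]
    funext j
    rw [Finset.sum_apply, Finset.sum_eq_single j]
    · split_ifs with h1
      · rw [h1]; exact (hcj j j.2 j j.2).trans (if_pos rfl)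
      · simp only [map_zero, Pi.zero_apply]
        generalize f j = z at *
        revert z; decide
    · intro i _ hij
      split_ifs with h1
      · exact (hcj i i.2 j j.2).trans (if_neg (fun h => hij (Subtype.ext h.symm)))
      · simp
    · simp
  · rintro ⟨a, ha⟩ ⟨u, hu⟩
    refine ⟨fun v => u v, ?_⟩
    funext i
    have h1 := LI_cob (ed_cont G i.2) (fun t ht => hu _ (hP (ed_mem G i.2 ht))) (t := 1) (by simp)
    rw [ed_zero, ed_one] at h1
    exact (add_comm _ _).trans h1.symm
  · have hc : ∀ z : ZMod 2, (fun _ => z : ↥G.verts → ZMod 2) ∈ (dl G).ker := by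
      intro z
      rw [AddMonoidHom.mem_ker]; funext i
      show z + z = 0
      grind
    have := Nat.card_le_card_of_injective (fun z : ZMod 2 => (⟨_, hc z⟩ : (dl G).ker)) (by
      intro z z' h
      obtain ⟨v⟩ := ‹Nonempty ↥G.verts›
      exact congrFun (congrArg Subtype.val h) v)
    simpa using this

theorem upper_bound [T2Space S] [TopologicalSpace.MetrizableSpace S] [ConnectedSpace S] (hS : Surf S)
    (hne : G.carrier.Nonempty) [Nonempty ↥G.verts] {P : Set S} (hPf : P.Finite) (hP : G.carrier ⊆ Pᶜ)
    (hext : ∀ c ∈ Zc Pᶜ, ∀ u, (∀ x ∈ G.carrier, Pr c u x) →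
      ∃ u', (∀ x ∈ Pᶜ, Pr c u' x) ∧ ∀ x ∈ G.carrier, u' x = u x) :
    HH P ≠ 0 ∧ HH P * 2 ^ G.verts.card ≤ 2 ^ G.edges.card * 2 := by
  classical
  have key := count_upper ((Bc Pᶜ).addSubgroupOf (Zc Pᶜ)) (per G Pᶜ hP) (dl G) ?_ ?_
  · simpa [HH, AddSubgroup.relIndex] using key
  · rintro ⟨c, hc⟩ ⟨w, hw⟩
    let w' : S → ZMod 2 := fun x => if h : x ∈ G.verts then w ⟨x, h⟩ else 0
    obtain ⟨u, hu, -⟩ := edge_prim G hne (c := c) (fun x hx => hc x (hP hx)) w' (fun i hi => by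
      have := congrFun hw ⟨i, hi⟩
      simp only [w', dif_pos (G.endpoint₀ i hi), dif_pos (G.endpoint₁ i hi)]
      exact this.symm)
    obtain ⟨u', hu', -⟩ := hext c hc u hu
    exact ⟨u', hu'⟩
  · have hconst : ∀ w ∈ (dl G).ker, ∀ x y, w x = w y := by
      intro w hw x y
      let w' : S → ZMod 2 := fun x => if h : x ∈ G.verts then w ⟨x, h⟩ else 0
      obtain ⟨u, hu, hu2, -⟩ := edge_prim G hne (c := 0) (fun x _ => LC.zero) w' (fun i hi => by
        have := congrFun hw ⟨i, hi⟩
        simp only [w', dif_pos (G.endpoint₀ i hi), dif_pos (G.endpoint₁ i hi)]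
        refine Eq.trans ?_ this.symm
        have h := LI_cob (c := (0 : S → S → ZMod 2)) (u := 0) (ed_cont G hi) (fun t _ => Pr.zero) (t := 1) (by simp)
        simpa using h)
      obtain ⟨u', hu', hu'G⟩ := hext 0 (zero_mem _) u hu
      obtain ⟨u'', hu'', hu''P⟩ := fill hS hPf (fun p _ => LC.zero) hu'
      have hv : ∀ v : ↥G.verts, u'' v = w v := by
        intro v
        have hvG := vert_mem G v.2
        rw [hu''P _ (hP hvG), hu'G _ hvG, hu2 _ v.2]
        simp [w']
      rw [← hv, ← hv]
      have h := Pr.const isPreconnected_univ (fun y _ => Pr.zero) (fun y _ => hu'' y) (mem_univ (y : S)) x (mem_univ _)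
      simpa using h
    obtain ⟨v⟩ := ‹Nonempty ↥G.verts›
    have := Nat.card_le_card_of_injective (fun w : (dl G).ker => w.1 v) (by
      intro w w' h
      apply Subtype.ext; funext x
      rw [hconst _ w.2 x v, hconst _ w'.2 x v]; exact h)
    simpa using this
end graphs
end EG
end
section
open Set Filter Topology
namespace EG

section reps
variable {S : Type} [TopologicalSpace S] (G : EmbeddedGraph S)

/-- a point of each face -/
noncomputable def rep (C : ConnectedComponents ↥(G.carrierᶜ)) : S := (Quotient.out C : ↥(G.carrierᶜ))

theorem rep_not_mem (C) : rep G C ∉ G.carrier := (Quotient.out C).2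

theorem rep_mk (C : ConnectedComponents ↥(G.carrierᶜ)) :
    ((Quotient.out C : ↥(G.carrierᶜ)) : ConnectedComponents ↥(G.carrierᶜ)) = C := Quotient.out_eq C

theorem mem_face_rep {x : S} (hx : x ∉ G.carrier) : ∃ C, x ∈ face G (rep G C) := by
  refine ⟨ConnectedComponents.mk ⟨x, hx⟩, ?_⟩
  rw [rep]
  refine (mem_face_iff G (Quotient.out (ConnectedComponents.mk (⟨x, hx⟩ : ↥(G.carrierᶜ)))) ⟨x, hx⟩).2 ?_
  rw [rep_mk]

theorem face_rep_disj {x : S} {C C'} (h : x ∈ face G (rep G C)) (h' : x ∈ face G (rep G C')) : C = C' := by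
  have e : face G (rep G C) = face G (rep G C') := (face_eq G h).trans (face_eq G h').symm
  have h1 : rep G C ∈ face G (rep G C') := e ▸ face_self G (rep_not_mem G C)
  have := (mem_face_iff G (Quotient.out C') (Quotient.out C)).1 h1
  rwa [rep_mk, rep_mk] at this

theorem ncard_range_reps {p : ConnectedComponents ↥(G.carrierᶜ) → S} (hp : ∀ C, p C ∈ face G (rep G C)) :
    (range p).ncard = G.numFaces := by
  have hinj : Function.Injective p := fun C C' h => face_rep_disj G (hp C) (h ▸ hp C')
  rw [← image_univ, ncard_image_of_injective _ hinj, ncard_univ]; rfl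

theorem verts_nonempty (hne : G.carrier.Nonempty) : Nonempty ↥G.verts := by
  obtain ⟨x, hx⟩ := hne
  rcases hx with hx | hx
  · exact ⟨⟨x, hx⟩⟩
  · simp only [mem_iUnion] at hx
    obtain ⟨i, hi, -⟩ := hx
    exact ⟨⟨_, G.endpoint₀ i hi⟩⟩

theorem ext_lemma [T2Space S] [CompactSpace S] (hS : Surf S) (hne : G.carrier.Nonempty)
    (φ : ConnectedComponents ↥(G.carrierᶜ) → ℝ × ℝ → S) (hφ : ∀ C, IsOpenEmbedding (φ C))
    (hr : ∀ C, range (φ C) = face G (rep G C)) :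
    ∀ c ∈ Zc (range fun C => φ C 0)ᶜ, ∀ u, (∀ x ∈ G.carrier, Pr c u x) →
      ∃ u', (∀ x ∈ (range fun C => φ C 0)ᶜ, Pr c u' x) ∧ ∀ x ∈ G.carrier, u' x = u x := by
  classical
  haveI := hS.locConn
  haveI := fin_faces G hS hne
  intro c hc u hu
  have hmem : ∀ C y, φ C y ∈ face G (rep G C) := fun C y => hr C ▸ mem_range_self y
  have hR : ∀ C, ∃ R, 0 ≤ R ∧ ∀ y ∈ Out R, Pr c u (φ C y) := by
    intro C
    have hcl : IsClosed (face G (rep G C) ∩ {y | Pr c u y}ᶜ) := by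
      rw [← isOpen_compl_iff, isOpen_iff_mem_nhds]
      intro y hy
      by_cases hyP : Pr c u y
      · filter_upwards [hyP.eventually] with a ha h using h.2 ha
      · rcases face_dec G (rep G C) y with h | h | ⟨N, hN, h⟩
        · exact absurd ⟨h, hyP⟩ hy
        · exact absurd (hu y h) hyP
        · filter_upwards [hN] with a ha h' using Set.disjoint_left.1 h ha h'.1
    have hK : IsCompact (φ C ⁻¹' {y | Pr c u y}ᶜ) := by
      rw [(hφ C).isEmbedding.isCompact_iff, image_preimage_eq_range_inter, hr]
      exact hcl.isCompact
    obtain ⟨R, hR⟩ := hK.isBounded.subset_closedBall 0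
    refine ⟨max R 0, le_max_right _ _, fun y hy => ?_⟩
    by_contra hcon
    have h := hR hcon
    simp only [Metric.mem_closedBall, Prod.dist_eq, Real.dist_eq, Prod.fst_zero, Prod.snd_zero,
        sub_zero, max_le_iff] at h
    rcases hy with hy | hy <;> have := (max_lt_iff.1 hy).1 <;> linarith [h.1, h.2]
  choose R hR0 hR using hR
  have hv : ∀ C, ∃ v : ℝ × ℝ → ZMod 2, (∀ y, y ≠ 0 → Pr (fun a b => c (φ C a) (φ C b)) v y) ∧
      ∀ y ∈ Out (R C), v y = u (φ C y) := by
    intro C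
    refine plane_ext (R C) (hR0 C) (fun a b => c (φ C a) (φ C b)) ?_ (u ∘ φ C) ?_
    · intro y hy
      refine LC.comp (hφ C).continuous.continuousAt (hc _ ?_)
      rintro ⟨C', hC'⟩
      have : C' = C := face_rep_disj G (hmem C' 0) (by rw [show φ C' 0 = φ C y from hC']; exact hmem C y)
      subst this
      exact hy ((hφ C').injective hC').symm
    · intro y hy
      exact (hR C y hy).comp (hφ C).continuous.continuousAt
  choose v hv1 hv2 using hv
  let u' : S → ZMod 2 := fun x => if h : ∃ q : _ × (ℝ × ℝ), φ q.1 q.2 = x then v h.choose.1 h.choose.2 else u x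
  have hu'φ : ∀ C y, u' (φ C y) = v C y := by
    intro C y
    have h : ∃ q : _ × (ℝ × ℝ), φ q.1 q.2 = φ C y := ⟨(C, y), rfl⟩
    have e : u' (φ C y) = v h.choose.1 h.choose.2 := dif_pos h
    rw [e]
    have hs := h.choose_spec
    generalize h.choose = q at hs
    obtain ⟨C', y'⟩ := q
    have : C' = C := face_rep_disj G (hmem C' y') (by rw [show φ C' y' = φ C y from hs]; exact hmem C y)
    subst this
    rw [(hφ C').injective hs]
  have hu'G : ∀ x ∈ G.carrier, u' x = u x := by
    intro x hx
    refine dif_neg ?_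
    rintro ⟨⟨C, y⟩, rfl⟩
    exact face_sub G _ (hmem C y) hx
  refine ⟨u', ?_, hu'G⟩
  intro x hx
  by_cases hxG : x ∈ G.carrier
  · refine (hu x hxG).congr0 ?_
    have hcl : IsClosed (⋃ C, φ C '' Metric.closedBall 0 (R C)) :=
      isClosed_iUnion_of_finite fun C => ((isCompact_closedBall _ _).image (hφ C).continuous).isClosed
    have hxn : x ∉ ⋃ C, φ C '' Metric.closedBall 0 (R C) := by
      simp only [mem_iUnion, not_exists]
      rintro C ⟨y, -, rfl⟩
      exact face_sub G _ (hmem C y) hxG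
    filter_upwards [hcl.isOpen_compl.mem_nhds hxn] with a ha
    by_cases haG : a ∈ G.carrier
    · exact hu'G a haG
    · obtain ⟨C, hC⟩ := mem_face_rep G haG
      rw [← hr C] at hC
      obtain ⟨y, rfl⟩ := hC
      rw [hu'φ]
      refine hv2 C y ?_
      by_contra hy
      apply ha
      refine mem_iUnion.2 ⟨C, y, ?_, rfl⟩
      simp only [Out, mem_ofPred_eq, not_or, not_lt] at hy
      simp only [Metric.mem_closedBall, Prod.dist_eq, Real.dist_eq, Prod.fst_zero, Prod.snd_zero,
        sub_zero, max_le_iff]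
      exact hy
  · obtain ⟨C, hC⟩ := mem_face_rep G hxG
    rw [← hr C] at hC
    obtain ⟨y, rfl⟩ := hC
    have hy0 : y ≠ 0 := by rintro rfl; exact hx ⟨C, rfl⟩
    refine (pr_push (hφ C) (hv1 C y hy0)).congr0 ?_
    filter_upwards [(hφ C).isOpen_range.mem_nhds (mem_range_self y)] with a ha
    obtain ⟨b, rfl⟩ := ha
    rw [hu'φ, Function.comp, Function.leftInverse_invFun (hφ C).injective]

/-- the upper bound for cellular graphs -/
theorem upper_cell [T2Space S] [CompactSpace S] [ConnectedSpace S] (hS : Surf S)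
    (hcell : ∀ x ∈ G.carrierᶜ, Nonempty (↥(connectedComponentIn G.carrierᶜ x) ≃ₜ (ℝ × ℝ))) :
    ∃ P : Set S, P.Finite ∧ P.ncard = G.numFaces ∧ G.carrier ⊆ Pᶜ ∧ ((∃ x, x ∉ G.carrier) → P.Nonempty) ∧ HH P ≠ 0 ∧
      HH P * 2 ^ G.verts.card ≤ 2 ^ G.edges.card * 2 := by
  haveI := hS.metrizable
  haveI := hS.locConn
  have hne : G.carrier.Nonempty := by
    by_contra h
    rw [not_nonempty_iff_eq_empty] at h
    obtain ⟨x⟩ := (inferInstance : Nonempty S)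
    obtain ⟨ψ⟩ := hcell x (by simp [h])
    have e : connectedComponentIn G.carrierᶜ x = univ := by
      rw [h, compl_empty, connectedComponentIn_univ]; exact PreconnectedSpace.connectedComponent_eq_univ x
    have : CompactSpace ↥(connectedComponentIn G.carrierᶜ x) := by
      rw [e]; exact isCompact_iff_compactSpace.1 isCompact_univ
    have := ψ.compactSpace
    exact noncompact_univ (ℝ × ℝ) isCompact_univ
  have hf := fin_faces G hS hne
  have hψ := fun C => hcell (rep G C) (rep_not_mem G C)
  let φ : ConnectedComponents ↥(G.carrierᶜ) → ℝ × ℝ → S := fun C => Subtype.val ∘ (hψ C).some.symm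
  have hφ : ∀ C, IsOpenEmbedding (φ C) := fun C =>
    (face_open G (rep G C)).isOpenEmbedding_subtypeVal.comp (hψ C).some.symm.isOpenEmbedding
  have hr : ∀ C, range (φ C) = face G (rep G C) := by
    intro C
    rw [range_comp, (hψ C).some.symm.surjective.range_eq, image_univ, Subtype.range_coe]; rfl
  have hp : ∀ C, φ C 0 ∈ face G (rep G C) := fun C => hr C ▸ mem_range_self _
  have hPG : G.carrier ⊆ (range fun C => φ C 0)ᶜ := by
    rintro x hx ⟨C, rfl⟩
    exact face_sub G _ (hp C) hx
  have := verts_nonempty G hne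
  refine ⟨range fun C => φ C 0, finite_range _, ncard_range_reps G hp, hPG, ?_,
    upper_bound G hS hne (finite_range _) hPG (ext_lemma G hS hne φ hφ hr)⟩
  rintro ⟨x, hx⟩
  obtain ⟨C, -⟩ := mem_face_rep G hx
  exact ⟨_, C, rfl⟩
end reps
end EG
end
section
open Set Filter Topology
namespace EG

section edgeclass
variable {S : Type} [TopologicalSpace S] (G : EmbeddedGraph S)

theorem ed_inj {i : ℕ} (hi : i ∈ G.edges) {s t : ℝ} (hs : s ∈ Ioo (0:ℝ) 1) (ht : t ∈ Icc (0:ℝ) 1)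
    (h : ed G i s = ed G i t) : s = t := by
  rw [ed_eq G i ⟨hs.1.le, hs.2.le⟩, ed_eq G i ht] at h
  rcases eq_or_lt_of_le ht.2 with h1 | h1
  · exfalso
    apply G.interior_avoids_verts i hi s hs
    rw [h, h1]; exact G.endpoint₁ i hi
  · exact G.inj i hi ⟨hs.1.le, hs.2⟩ ⟨ht.1, h1⟩ h

theorem ed_ne {i j : ℕ} (hi : i ∈ G.edges) (hj : j ∈ G.edges) (hij : i ≠ j) {s t : ℝ} (hs : s ∈ Ioo (0:ℝ) 1)
    (ht : t ∈ Icc (0:ℝ) 1) : ed G i s ≠ ed G j t := by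
  intro h
  rw [ed_eq G i ⟨hs.1.le, hs.2.le⟩, ed_eq G j ht] at h
  have h3 := G.interior_avoids_verts i hi s hs
  rcases eq_or_lt_of_le ht.2 with h1 | h1
  · apply h3; rw [h, h1]; exact G.endpoint₁ j hj
  rcases eq_or_lt_of_le ht.1 with h2 | h2
  · apply h3; rw [h, ← h2]; exact G.endpoint₀ j hj
  exact G.interiors_disjoint i hi j hj hij s hs t ⟨h2, h1⟩ h

theorem arc_data [T2Space S] {i : ℕ} (hi : i ∈ G.edges) : ∃ A₁ A₂ G' : Set S, IsClosed A₁ ∧ IsClosed A₂ ∧ IsClosed G' ∧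
    (∀ a, a ∈ A₁ → a ∈ A₂ → a = ed G i (1/2)) ∧ (∀ t ∈ Icc (1/4:ℝ) (1/2), ed G i t ∈ A₁) ∧
    (∀ t ∈ Icc (1/2:ℝ) (3/4), ed G i t ∈ A₂) ∧ ed G i (1/2) ∉ G' ∧ (∀ a ∈ G.carrier, a ∈ G' ∨ a ∈ A₁ ∨ a ∈ A₂) ∧
    (∀ v ∈ G.verts, v ∈ G') ∧ (∀ j ∈ G.edges, j ≠ i → ∀ t ∈ Icc (0:ℝ) 1, ed G j t ∈ G') := by
  have hg := ed_cont G hi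
  have hK : ∀ a b : ℝ, IsClosed (ed G i '' Icc a b) := fun a b => (isCompact_Icc.image hg).isClosed
  refine ⟨ed G i '' Icc (1/4) (1/2), ed G i '' Icc (1/2) (3/4),
    (G.verts : Set S) ∪ (⋃ j ∈ (G.edges : Set ℕ) \ {i}, ed G j '' Icc 0 1) ∪ (ed G i '' Icc 0 (1/4) ∪ ed G i '' Icc (3/4) 1),
    hK _ _, hK _ _, ?_, ?_, fun t ht => mem_image_of_mem _ ht, fun t ht => mem_image_of_mem _ ht, ?_, ?_, ?_, ?_⟩
  · refine (G.verts.finite_toSet.isClosed.union ?_).union ((hK _ _).union (hK _ _))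
    exact (G.edges.finite_toSet.subset sdiff_subset).isClosed_biUnion fun j hj =>
      (isCompact_Icc.image (ed_cont G hj.1)).isClosed
  · rintro _ ⟨s, hs, rfl⟩ ⟨t, ht, h⟩
    have := ed_inj G hi (s := t) (t := s) ⟨by linarith [ht.1], by linarith [ht.2]⟩ ⟨by linarith [hs.1], by linarith [hs.2]⟩ h
    congr 1; linarith [hs.2, ht.1]
  · have h2 : (1/2:ℝ) ∈ Ioo (0:ℝ) 1 := by norm_num
    rintro ((h | h) | ⟨s, hs, h⟩ | ⟨s, hs, h⟩)
    · rw [ed_eq G i (Ioo_subset_Icc_self h2)] at h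
      exact G.interior_avoids_verts i hi _ h2 h
    · simp only [mem_iUnion] at h
      obtain ⟨j, hj, t, ht, h⟩ := h
      exact ed_ne G hi hj.1 (fun e => hj.2 e.symm) h2 ht h.symm
    · have := ed_inj G hi h2 ⟨hs.1, by linarith [hs.2]⟩ h.symm
      linarith [hs.2]
    · have := ed_inj G hi h2 ⟨by linarith [hs.1], hs.2⟩ h.symm
      linarith [hs.1]
  · intro a ha
    rw [carrier_eq] at ha
    rcases ha with ha | ha
    · exact Or.inl (Or.inl (Or.inl ha))
    · simp only [mem_iUnion] at ha
      obtain ⟨j, hj, t, ht, rfl⟩ := ha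
      by_cases hji : j = i
      · subst hji
        rcases le_total t (1/4) with h | h
        · exact Or.inl (Or.inr (Or.inl ⟨t, ⟨ht.1, h⟩, rfl⟩))
        rcases le_total t (1/2) with h' | h'
        · exact Or.inr (Or.inl ⟨t, ⟨h, h'⟩, rfl⟩)
        rcases le_total t (3/4) with h'' | h''
        · exact Or.inr (Or.inr ⟨t, ⟨h', h''⟩, rfl⟩)
        · exact Or.inl (Or.inr (Or.inr ⟨t, ⟨h'', ht.2⟩, rfl⟩))
      · refine Or.inl (Or.inl (Or.inr ?_))
        simp only [mem_iUnion]
        exact ⟨j, ⟨hj, hji⟩, t, ht, rfl⟩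
  · exact fun v hv => Or.inl (Or.inl hv)
  · intro j hj hji t ht
    refine Or.inl (Or.inr ?_)
    simp only [mem_iUnion]
    exact ⟨j, ⟨hj, hji⟩, t, ht, rfl⟩

theorem chart_small (hS : Surf S) {x : S} {F : Set S} (hF : IsClosed F) (hx : x ∉ F) :
    ∃ φ : ℝ × ℝ → S, ∃ ρ > 0, IsOpenEmbedding φ ∧ φ 0 = x ∧ ∀ y ∈ Metric.closedBall 0 ρ, φ y ∉ F := by
  obtain ⟨φ, hφ, h0⟩ := hS x
  have : φ ⁻¹' Fᶜ ∈ 𝓝 0 := hφ.continuous.continuousAt.preimage_mem_nhds (by rw [h0]; exact hF.isOpen_compl.mem_nhds hx)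
  obtain ⟨ρ, h1, h2⟩ := Metric.nhds_basis_closedBall.mem_iff.1 this
  exact ⟨φ, ρ, h1, hφ, h0, fun y hy => h2 hy⟩

theorem carrier_ne_univ [T2Space S] [Nonempty S] (hS : Surf S) : ∃ x, x ∉ G.carrier := by
  by_cases hE : ∃ i, i ∈ G.edges
  · obtain ⟨i, hi⟩ := hE
    obtain ⟨A₁, A₂, G', hA₁, hA₂, hG', hA, h1, h2, hx, hc, -, -⟩ := arc_data G hi
    obtain ⟨φ, ρ, hρ, hφ, h0, hφG⟩ := chart_small hS hG' hx
    have hT : IsPreconnected (φ '' (Metric.ball 0 ρ \ {0})) :=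
      (punctured_ball ρ hρ).image _ hφ.continuous.continuousOn
    have hnear : ∀ᶠ t in 𝓝 (1/2:ℝ), ed G i t ∈ φ '' Metric.ball 0 ρ :=
      (ed_cont G hi).continuousAt.preimage_mem_nhds
        ((hφ.isOpenMap _ Metric.isOpen_ball).mem_nhds ⟨0, Metric.mem_ball_self hρ, h0⟩)
    have hT' : ∀ t ∈ Ioo (1/4:ℝ) (3/4), t ≠ 1/2 → ed G i t ∈ φ '' Metric.ball 0 ρ →
        ed G i t ∈ φ '' (Metric.ball 0 ρ \ {0}) ∧ ed G i t ≠ ed G i (1/2) := by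
      intro t ht htn h
      have hne : ed G i t ≠ ed G i (1/2) := fun h => htn
        (ed_inj G hi ⟨by linarith [ht.1], by linarith [ht.2]⟩ (by norm_num) h)
      obtain ⟨y, hy, e⟩ := h
      refine ⟨⟨y, ⟨hy, ?_⟩, e⟩, hne⟩
      rintro rfl
      exact hne (by rw [← e, h0])
    have hl : ∃ t ∈ Ioo (1/4:ℝ) (1/2), ed G i t ∈ φ '' Metric.ball 0 ρ := by
      have := (hnear.filter_mono nhdsWithin_le_nhds).and (Ioo_mem_nhdsLT (show (1/4:ℝ) < 1/2 by norm_num))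
      obtain ⟨t, ht⟩ := this.exists
      exact ⟨t, ht.2, ht.1⟩
    have hr : ∃ t ∈ Ioo (1/2:ℝ) (3/4), ed G i t ∈ φ '' Metric.ball 0 ρ := by
      have := (hnear.filter_mono nhdsWithin_le_nhds).and (Ioo_mem_nhdsGT (show (1/2:ℝ) < 3/4 by norm_num))
      obtain ⟨t, ht⟩ := this.exists
      exact ⟨t, ht.2, ht.1⟩
    obtain ⟨s, hs, hs'⟩ := hl
    obtain ⟨t, ht, ht'⟩ := hr
    obtain ⟨hs1, hs2⟩ := hT' s ⟨hs.1, by linarith [hs.2]⟩ hs.2.ne hs'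
    obtain ⟨ht1, ht2⟩ := hT' t ⟨by linarith [ht.1], ht.2⟩ ht.1.ne' ht'
    obtain ⟨z, hz, hz1, hz2⟩ := hT A₂ᶜ A₁ᶜ hA₂.isOpen_compl hA₁.isOpen_compl (by
      rintro z ⟨y, hy, rfl⟩
      by_contra hcon
      simp only [mem_union, mem_compl_iff, not_or, not_not] at hcon
      have := hA _ hcon.2 hcon.1
      rw [← h0] at this
      exact hy.2 (hφ.injective this))
      ⟨_, hs1, fun h => hs2 (hA _ (h1 s ⟨hs.1.le, hs.2.le⟩) h)⟩
      ⟨_, ht1, fun h => ht2 (hA _ h (h2 t ⟨ht.1.le, ht.2.le⟩))⟩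
    refine ⟨z, fun hzc => ?_⟩
    rcases hc z hzc with h | h | h
    · obtain ⟨y, hy, rfl⟩ := hz
      exact hφG y (Metric.ball_subset_closedBall hy.1) h
    · exact hz2 h
    · exact hz1 h
  · by_contra hcon
    push Not at hcon hE
    have hu : (univ : Set S).Finite := by
      refine G.verts.finite_toSet.subset fun x _ => ?_
      have := hcon x
      simpa [EmbeddedGraph.carrier, hE] using this
    obtain ⟨x⟩ := ‹Nonempty S›
    obtain ⟨φ, hφ, -⟩ := hS x
    have : Finite S := finite_univ_iff.1 hu
    have := Finite.of_injective φ hφ.injective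
    exact not_finite (ℝ × ℝ)
end edgeclass
end EG
end
section
open Set Filter Topology
namespace EG

section edgeclass2
variable {S : Type} [TopologicalSpace S] (G : EmbeddedGraph S)

/-- a step function separating two closed sets -/
theorem step_fun [TopologicalSpace.MetrizableSpace S] {A₁ A₂ : Set S} (h1 : IsClosed A₁) (h2 : IsClosed A₂)
    (hn1 : A₁.Nonempty) (hn2 : A₂.Nonempty) :
    ∃ l : S → ZMod 2, (∀ a ∈ A₁, l a = 0) ∧ (∀ a ∈ A₁, a ∉ A₂ → ∀ᶠ b in 𝓝 a, l b = 0) ∧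
      (∀ a ∈ A₂, a ∉ A₁ → ∀ᶠ b in 𝓝 a, l b = 1) := by
  classical
  letI := TopologicalSpace.metrizableSpaceMetric S
  refine ⟨fun a => if Metric.infDist a A₂ < Metric.infDist a A₁ then 1 else 0, ?_, ?_, ?_⟩
  · intro a ha
    refine if_neg ?_
    rw [Metric.infDist_zero_of_mem ha]
    exact not_lt.2 Metric.infDist_nonneg
  · intro a ha ha2
    have : Metric.infDist a A₁ < Metric.infDist a A₂ := by
      rw [Metric.infDist_zero_of_mem ha]; exact (h2.notMem_iff_infDist_pos hn2).1 ha2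
    filter_upwards [((Metric.continuous_infDist_pt A₁).continuousAt.eventually_lt
      (Metric.continuous_infDist_pt A₂).continuousAt this)] with b hb
    exact if_neg (not_lt.2 hb.le)
  · intro a ha ha2
    have : Metric.infDist a A₂ < Metric.infDist a A₁ := by
      rw [Metric.infDist_zero_of_mem ha]; exact (h1.notMem_iff_infDist_pos hn1).1 ha2
    filter_upwards [((Metric.continuous_infDist_pt A₂).continuousAt.eventually_lt
      (Metric.continuous_infDist_pt A₁).continuousAt this)] with b hb
    exact if_pos hb

theorem edge_class [T2Space S] [TopologicalSpace.MetrizableSpace S] [LocallyConnectedSpace S] (hS : Surf S)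
    [Finite (ConnectedComponents ↥(G.carrierᶜ))] {i : ℕ} (hi : i ∈ G.edges) :
    ∃ c ∈ Zc (range (rep G))ᶜ, ∀ j ∈ G.edges, LI c (ed G j) 1 = if j = i then 1 else 0 := by
  classical
  obtain ⟨A₁, A₂, G', hA₁, hA₂, hG', hA, h1, h2, hx, hc, hGv, hGe⟩ := arc_data G hi
  obtain ⟨φ, ρ, hρ, hφ, h0, hφG⟩ := chart_small hS hG' hx
  obtain ⟨l, hl0, hl1, hl2⟩ := step_fun hA₁ hA₂ ⟨_, h1 (1/2) (by norm_num)⟩ ⟨_, h2 (1/2) (by norm_num)⟩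
  let c₀ : ℝ × ℝ → ℝ × ℝ → ZMod 2 := fun a b =>
    if a ∈ Metric.closedBall 0 ρ ∧ b ∈ Metric.closedBall 0 ρ then l (φ a) + l (φ b) else 0
  have hc₀ : ∀ a b, c₀ a b ≠ 0 → a ∈ Metric.closedBall 0 ρ ∧ b ∈ Metric.closedBall 0 ρ := by
    intro a b h
    by_contra hn
    exact h (if_neg hn)
  let C₀ := push φ c₀
  -- local vanishing
  have hz0 : ∀ z, z ∉ φ '' Metric.closedBall 0 ρ → Pr C₀ 0 z := fun z hz =>
    push_zero hφ.continuous (isCompact_closedBall _ _) hc₀ hz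
  have hzk : ∀ z ∈ range φ, ∀ k : ZMod 2, (∀ᶠ b in 𝓝 z, l b = k) → Pr C₀ 0 z := by
    intro z hz k hk
    refine ⟨range φ ∩ {b | l b = k}, inter_mem (hφ.isOpen_range.mem_nhds hz) hk, ?_⟩
    rintro _ ⟨⟨a, rfl⟩, ha⟩ _ ⟨⟨b, rfl⟩, hb⟩
    simp only [mem_ofPred_eq] at ha hb
    simp only [C₀, push_apply hφ, c₀, ha, hb, Pi.zero_apply]
    split_ifs <;> grind
  have hz : ∀ z ∈ G.carrier, z ≠ ed G i (1/2) → Pr C₀ 0 z := by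
    intro z hzG hzx
    by_cases hzB : z ∈ φ '' Metric.closedBall 0 ρ
    · have hzr : z ∈ range φ := image_subset_range _ _ hzB
      rcases hc z hzG with h | h | h
      · obtain ⟨y, hy, rfl⟩ := hzB
        exact absurd h (hφG y hy)
      · exact hzk z hzr 0 (hl1 z h (fun h' => hzx (hA z h h')))
      · exact hzk z hzr 1 (hl2 z h (fun h' => hzx (hA z h' h)))
    · exact hz0 z hzB
  have hzx : Pr C₀ l (ed G i (1/2)) := by
    refine ⟨φ '' Metric.ball 0 ρ, (hφ.isOpenMap _ Metric.isOpen_ball).mem_nhds ⟨0, Metric.mem_ball_self hρ, h0⟩, ?_⟩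
    rintro _ ⟨a, ha, rfl⟩ _ ⟨b, hb, rfl⟩
    simp only [C₀, push_apply hφ, c₀]
    exact if_pos ⟨Metric.ball_subset_closedBall ha, Metric.ball_subset_closedBall hb⟩
  have hC₀ : ∀ z ∈ G.carrier, LC C₀ z := by
    intro z hzG
    by_cases h : z = ed G i (1/2)
    · rw [h]; exact ⟨_, hzx⟩
    · exact ⟨_, hz z hzG h⟩
  -- extension in the plane
  obtain ⟨c', w, Q, hQf, hQM, hc', hc's, hw, hws⟩ := plane_grid c₀ (φ ⁻¹' G.carrier)
    ((carrier_compact G).isClosed.preimage hφ.continuous)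
    (fun y hy => by
      have := (hC₀ (φ y) hy).comp hφ.continuous.continuousAt
      rwa [push_comp hφ] at this) ρ hc₀
  let C := push φ c'
  have hC : ∀ z, z ∉ φ '' Q → LC C z := by
    intro z hz
    by_cases hzr : z ∈ range φ
    · obtain ⟨y, rfl⟩ := hzr
      refine lc_push hφ ?_
      rw [push_comp hφ]
      exact hc' y (fun h => hz ⟨y, h, rfl⟩)
    · exact ⟨_, push_zero hφ.continuous (isCompact_closedBall _ _) hc's (fun h => hzr (image_subset_range _ _ h))⟩
  have hQG : ∀ z ∈ φ '' Q, z ∉ G.carrier := by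
    rintro _ ⟨y, hy, rfl⟩ h
    exact Set.disjoint_left.1 hQM hy h
  have hCG : ∀ z ∈ G.carrier, LC C z := fun z hz => hC z (fun h => hQG z h hz)
  let W : S → ZMod 2 := fun z => if z ∈ φ '' Metric.closedBall 0 ρ then w (Function.invFun φ z) else 0
  have hWφ : ∀ y, W (φ y) = w y := by
    intro y
    by_cases hy : y ∈ Metric.closedBall 0 ρ
    · exact (if_pos ⟨y, hy, rfl⟩).trans (by rw [Function.leftInverse_invFun hφ.injective])
    · have : W (φ y) = 0 := if_neg (by rintro ⟨y', h, e⟩; exact hy (hφ.injective e ▸ h))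
      rw [this]
      by_contra h
      exact hy (hws y (Ne.symm h))
  have hW : ∀ z ∈ G.carrier, Pr (C₀ + C) W z := by
    intro z hzG
    by_cases hzr : z ∈ range φ
    · obtain ⟨y, rfl⟩ := hzr
      have h := hw y hzG
      have e : (fun a b => (C₀ + C) (φ a) (φ b)) = c₀ + c' := by
        funext a b
        simp only [C₀, C, Pi.add_apply, push_apply hφ]
      rw [← e] at h
      refine (pr_push hφ h).congr0 ?_
      filter_upwards [hφ.isOpen_range.mem_nhds (mem_range_self y)] with a ha
      obtain ⟨b, rfl⟩ := ha
      rw [hWφ, Function.comp, Function.leftInverse_invFun hφ.injective]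
    · have hn : ∀ r, z ∉ φ '' Metric.closedBall 0 r := fun r h => hzr (image_subset_range _ _ h)
      refine ((hz0 z (hn _)).add (push_zero hφ.continuous (isCompact_closedBall _ _) hc's (hn _))).congr0 ?_
      have hcl : IsClosed (φ '' Metric.closedBall 0 ρ) := ((isCompact_closedBall _ _).image hφ.continuous).isClosed
      filter_upwards [hcl.isOpen_compl.mem_nhds (hn ρ)] with a ha
      have hWa : W a = 0 := if_neg ha
      simp [hWa]
  have hWv : ∀ v ∈ G.verts, W v = 0 := by
    intro v hv
    refine if_neg ?_
    rintro ⟨y, hy, rfl⟩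
    exact hφG y hy (hGv _ hv)
  -- line integrals
  have h01 : (1:ℝ) ∈ Icc (0:ℝ) 1 := by norm_num
  have hLI : ∀ j ∈ G.edges, LI C (ed G j) 1 = LI C₀ (ed G j) 1 := by
    intro j hj
    have e1 := LI_cob (ed_cont G hj) (fun t ht => hW _ (ed_mem G hj ht)) h01
    rw [LI_add (ed_cont G hj) (fun t ht => hC₀ _ (ed_mem G hj ht)) (fun t ht => hCG _ (ed_mem G hj ht)) h01,
      ed_zero, ed_one, hWv _ (G.endpoint₀ j hj), hWv _ (G.endpoint₁ j hj)] at e1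
    grind
  have hLI₀ : ∀ j ∈ G.edges, LI C₀ (ed G j) 1 = if j = i then 1 else 0 := by
    intro j hj
    split_ifs with hji
    · subst hji
      have e := LI_eq (c := C₀) (g := ed G j) (u := fun t => if 1/2 < t then 1 else 0) (fun t ht => ?_) h01
      · rw [e, if_pos (by norm_num), if_neg (by norm_num), add_zero]
      · rcases lt_trichotomy t (1/2) with h | h | h
        · have hne : ed G j t ≠ ed G j (1/2) := fun h' => h.ne
            (ed_inj G hj (s := 1/2) (by norm_num) ht h'.symm).symm
          refine ((hz _ (ed_mem G hj ht) hne).comp (ed_cont G hj).continuousAt).congr (k := 0) ?_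
          filter_upwards [Iio_mem_nhds h] with s hs
          simpa using (mem_Iio.1 hs).le
        · subst h
          refine (hzx.comp (ed_cont G hj).continuousAt).congr0 ?_
          filter_upwards [Ioo_mem_nhds (show (1/4:ℝ) < 1/2 by norm_num) (show (1/2:ℝ) < 3/4 by norm_num)] with s hs
          by_cases h : 1/2 < s
          · rw [if_pos h]
            refine ((hl2 _ (h2 s ⟨h.le, hs.2.le⟩) ?_).self_of_nhds).symm
            intro h'
            have := hA _ h' (h2 s ⟨h.le, hs.2.le⟩)
            exact h.ne' (ed_inj G hj ⟨by linarith, by linarith [hs.2]⟩ (by norm_num) this)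
          · rw [if_neg h]
            exact (hl0 _ (h1 s ⟨hs.1.le, not_lt.1 h⟩)).symm
        · have hne : ed G j t ≠ ed G j (1/2) := fun h' => h.ne'
            (ed_inj G hj (s := 1/2) (by norm_num) ht h'.symm).symm
          refine ((hz _ (ed_mem G hj ht) hne).comp (ed_cont G hj).continuousAt).congr (k := 1) ?_
          filter_upwards [Ioi_mem_nhds h] with s hs
          rw [if_pos (mem_Ioi.1 hs)]; simp
    · have e := LI_cob (c := C₀) (u := 0) (ed_cont G hj) (fun t ht => hz _ (ed_mem G hj ht) (fun h => hx (h ▸ hGe j hj hji t ht))) h01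
      simpa using e
  -- move the punctures
  obtain ⟨c'', hc'', hL⟩ := move_all hS G.carrier (range (rep G)) (finite_range _) (hQf.image φ) C (by
      intro q hq
      obtain ⟨K, hK⟩ := mem_face_rep G (hQG q hq)
      exact ⟨_, ⟨K, rfl⟩, _, face_open G (rep G K), face_pre G _, hK, face_self G (rep_not_mem G K), face_sub G _⟩)
    (fun y hy _ => hC y hy)
  refine ⟨c'', hc'', fun j hj => ?_⟩
  rw [LI_congr (ed_cont G hj) (fun t ht => hCG _ (ed_mem G hj ht)) (fun t ht => hL _ (ed_mem G hj ht)) h01,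
    hLI j hj, hLI₀ j hj]

theorem euler_ineq [T2Space S] [CompactSpace S] [ConnectedSpace S] (hS : Surf S) (hne : G.carrier.Nonempty)
    (G₀ : EmbeddedGraph S)
    (hcell : ∀ x ∈ G₀.carrierᶜ, Nonempty (↥(connectedComponentIn G₀.carrierᶜ x) ≃ₜ (ℝ × ℝ))) :
    G.edges.card + G₀.verts.card + G₀.numFaces ≤ G₀.edges.card + G.verts.card + G.numFaces := by
  have := hS.metrizable
  have := hS.locConn
  have := fin_faces G hS hne
  have := verts_nonempty G hne
  obtain ⟨P₀, hP₀, hcard₀, -, hn, h0, hle⟩ := upper_cell G₀ hS hcell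
  have hP₀n := hn (carrier_ne_univ G₀ hS)
  have hcard := ncard_range_reps G (p := rep G) (fun C => face_self G (rep_not_mem G C))
  have hPn : (range (rep G)).Nonempty := by
    obtain ⟨x, hx⟩ := carrier_ne_univ G hS
    obtain ⟨C, -⟩ := mem_face_rep G hx
    exact ⟨_, C, rfl⟩
  have hcmp := HH_compare hS (finite_range (rep G)) hPn hP₀ hP₀n
  rw [hcard, hcard₀] at hcmp
  have h0' : HH (range (rep G)) ≠ 0 := by
    intro h
    rw [h, zero_mul] at hcmp
    have := mul_pos (Nat.pos_of_ne_zero h0) (pow_pos (two_pos : 0 < 2) G.numFaces)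
    omega
  have hlow := lower_bound G (P := range (rep G)) (by rintro x hx ⟨C, rfl⟩; exact rep_not_mem G C hx) h0'
    (fun i hi => edge_class G hS hi)
  rw [← Nat.pow_le_pow_iff_right (a := 2) (by norm_num)]
  have := calc 2 ^ (G.edges.card + G₀.verts.card + G₀.numFaces) * 2
      = (2 ^ G.edges.card * 2) * (2 ^ G₀.verts.card * 2 ^ G₀.numFaces) := by ring
    _ ≤ (HH (range (rep G)) * 2 ^ G.verts.card) * (2 ^ G₀.verts.card * 2 ^ G₀.numFaces) := by gcongr
    _ = (HH (range (rep G)) * 2 ^ G₀.numFaces) * (2 ^ G.verts.card * 2 ^ G₀.verts.card) := by ring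
    _ = (HH P₀ * 2 ^ G₀.verts.card) * (2 ^ G.numFaces * 2 ^ G.verts.card) := by rw [hcmp]; ring
    _ ≤ (2 ^ G₀.edges.card * 2) * (2 ^ G.numFaces * 2 ^ G.verts.card) := by gcongr
    _ = 2 ^ (G₀.edges.card + G.verts.card + G.numFaces) * 2 := by ring
  omega
end edgeclass2
end EG
end

open Classical in
/-- Combination of the Euler inequality with the degree count: for a graph
embedded in a closed orientable surface of genus `g`, with every vertex of
degree at least `2`, at least `n` vertices of degree at least `3`, and a
distinguished collection of `h` faces, the number `f'` of non-distinguished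
faces satisfies `f' ≥ n/2 + 2 - 2g - h`. -/
theorem stmt_10 (S : Type) [TopologicalSpace S] (g n h : ℕ)
    (hS : IsClosedSurfaceOfGenus S g) (G : EmbeddedGraph S)
    (deg : S → ℕ)
    (hdeg : ∀ v : S, deg v = (G.edges.filter (fun i => G.param i 0 = v)).card +
      (G.edges.filter (fun i => G.param i 1 = v)).card)
    (hmin : ∀ v ∈ G.verts, 2 ≤ deg v)
    (hn : n ≤ (G.verts.filter (fun v => 3 ≤ deg v)).card)
    (hne : G.carrier.Nonempty)
    (D : Set (ConnectedComponents ↥(G.carrierᶜ))) (hD : Nat.card D = h) :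
    (n : ℤ) + 4 - 4 * (g : ℤ) - 2 * (h : ℤ) ≤
      2 * (Nat.card {c : ConnectedComponents ↥(G.carrierᶜ) | c ∉ D} : ℤ) := by
  obtain ⟨hc, hconn, hT2, hch, G₀, hcell, heul⟩ := hS
  have hSf := EG.surf_of hch
  have hfin := EG.fin_faces G hSf hne
  have hineq := EG.euler_ineq G hSf hne G₀ hcell
  -- degree count
  have hsum : ∑ v ∈ G.verts, deg v = 2 * G.edges.card := by
    simp only [hdeg, Finset.sum_add_distrib]
    rw [← Finset.card_eq_sum_card_fiberwise (fun i hi => G.endpoint₀ i hi),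
      ← Finset.card_eq_sum_card_fiberwise (fun i hi => G.endpoint₁ i hi)]
    ring
  have hdc : 2 * G.verts.card + n ≤ 2 * G.edges.card := by
    rw [← hsum]
    calc 2 * G.verts.card + n ≤ 2 * G.verts.card + (G.verts.filter (fun v => 3 ≤ deg v)).card := by gcongr
      _ = ∑ v ∈ G.verts, (2 + if 3 ≤ deg v then 1 else 0) := by
        rw [Finset.sum_add_distrib, Finset.card_filter]; simp [mul_comm]
      _ ≤ ∑ v ∈ G.verts, deg v := by
        refine Finset.sum_le_sum fun v hv => ?_
        have := hmin v hv
        split_ifs <;> omega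
  -- distinguished faces
  have hf : Nat.card D + Nat.card {c : ConnectedComponents ↥(G.carrierᶜ) | c ∉ D} = G.numFaces :=
    Set.ncard_add_ncard_compl D
  rw [hD] at hf
  omega
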